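/- Let A be an analytic subset of NU. Then there exists an analytic subset A' of NU such that: (i) every Y ∈ A' has a Schauder basis; (ii) for every X ∈ A there exists Y ∈ A' containing an isometric copy of X. -/

import Mathlib

open Filter Topology MeasureTheory

noncomputable section

/-! ### The Cantor set and the space `C(2^ℕ)` -/

/-- The Cantor set `2^ℕ`. -/
abbrev CantorSet : Type := ℕ → Bool

/-- The Banach space `C(2^ℕ)` of continuous real-valued functions on the Cantor set. -/
abbrev CantorC : Type := C(CantorSet, ℝ)

/-! ### The standard Borel space `SB` of separable Banach spaces -/

/-- `SB`: the set of closed linear subspaces of `C(2^ℕ)`. -/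
def SB : Type := {Y : Submodule ℝ CantorC // IsClosed (Y : Set CantorC)}

/-- The Effros-Borel σ-algebra on `SB`, generated by the sets
`{Y : Y ∩ U ≠ ∅}` for `U` open in `C(2^ℕ)`. -/
instance : MeasurableSpace SB :=
  MeasurableSpace.generateFrom
    {A : Set SB | ∃ U : Set CantorC, IsOpen U ∧ A = {Y : SB | ((Y.1 : Set CantorC) ∩ U).Nonempty}}

/-- A subset of a standard Borel space is analytic if it is the image of a Borel map
from the Baire space `ℕ^ℕ`. -/
def IsAnalyticIn {α : Type*} [MeasurableSpace α] (A : Set α) : Prop :=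
  ∃ f : (ℕ → ℕ) → α, Measurable f ∧ A = Set.range f

/-! ### Embeddings, isomorphisms, universality -/

/-- `X` embeds isomorphically into `Y`: there is a bounded linear map which is
bounded below, i.e. an isomorphism onto its range. -/
def Embeds (X Y : Type*) [SeminormedAddCommGroup X] [NormedSpace ℝ X]
    [SeminormedAddCommGroup Y] [NormedSpace ℝ Y] : Prop :=
  ∃ (T : X →L[ℝ] Y) (c : ℝ), 0 < c ∧ ∀ x : X, c * ‖x‖ ≤ ‖T x‖

/-- `X` embeds isometrically into `Y` (i.e. `Y` contains an isometric copy of `X`). -/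
def EmbedsIsometrically (X Y : Type*) [SeminormedAddCommGroup X] [NormedSpace ℝ X]
    [SeminormedAddCommGroup Y] [NormedSpace ℝ Y] : Prop :=
  Nonempty (X →ₗᵢ[ℝ] Y)

/-- `X` and `Y` are isomorphic Banach spaces (linearly homeomorphic). -/
def IsomorphicTo (X Y : Type*) [SeminormedAddCommGroup X] [NormedSpace ℝ X]
    [SeminormedAddCommGroup Y] [NormedSpace ℝ Y] : Prop :=
  Nonempty (X ≃L[ℝ] Y)

/-- The class `NU ⊆ SB` of non-universal spaces: those `X ∈ SB` which do not contain
an isomorphic copy of `C(2^ℕ)` (equivalently, are not universal for all separable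
Banach spaces). -/
def NU : Set SB := {Y : SB | ¬ Embeds CantorC Y.1}

/-- The class `NC_X ⊆ SB` of all `Y ∈ SB` containing no isomorphic copy of `X`. -/
def NCin (X : Type*) [SeminormedAddCommGroup X] [NormedSpace ℝ X] : Set SB :=
  {Y : SB | ¬ Embeds X Y.1}

/-! ### Schauder bases -/

/-- `x` is a Schauder basis of `E`: every vector has a unique representation as a
norm convergent series `Σ aₙ • xₙ`. -/
def IsSchauderBasis {E : Type*} [SeminormedAddCommGroup E] [NormedSpace ℝ E]
    (x : ℕ → E) : Prop :=
  ∀ y : E, ∃! a : ℕ → ℝ,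
    Tendsto (fun m => ∑ n ∈ Finset.range m, a n • x n) atTop (𝓝 y)

/-- `E` has a Schauder basis. -/
def HasSchauderBasis (E : Type*) [SeminormedAddCommGroup E] [NormedSpace ℝ E] : Prop :=
  ∃ x : ℕ → E, IsSchauderBasis x

/-- `x` is a monotone basis sequence: initial-segment projections have norm at most 1. -/
def IsMonotoneSeq {E : Type*} [SeminormedAddCommGroup E] [NormedSpace ℝ E]
    (x : ℕ → E) : Prop :=
  ∀ (a : ℕ → ℝ) (k m : ℕ), k ≤ m →
    ‖∑ n ∈ Finset.range k, a n • x n‖ ≤ ‖∑ n ∈ Finset.range m, a n • x n‖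

/-- `x` is a bi-monotone sequence: interval projections have norm at most 1. -/
def IsBimonotoneSeq {E : Type*} [SeminormedAddCommGroup E] [NormedSpace ℝ E]
    (x : ℕ → E) : Prop :=
  ∀ (a : ℕ → ℝ) (j k m : ℕ), j ≤ k → k ≤ m →
    ‖∑ n ∈ Finset.Ico j k, a n • x n‖ ≤ ‖∑ n ∈ Finset.range m, a n • x n‖

/-- `x` is a Schauder basic sequence: it is a Schauder basis of its closed linear span. -/
def IsSchauderBasicSeq {E : Type*} [NormedAddCommGroup E] [NormedSpace ℝ E]
    (x : ℕ → E) : Prop :=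
  ∀ y ∈ (Submodule.span ℝ (Set.range x)).topologicalClosure,
    ∃! a : ℕ → ℝ,
      Tendsto (fun m => ∑ n ∈ Finset.range m, a n • x n) atTop (𝓝 y)

/-! ### Trees, ordinal ranks and Bourgain's index -/

/-- A tree on `Λ`: a set of finite sequences closed under initial segments. -/
def IsTree {Λ : Type*} (T : Set (List Λ)) : Prop :=
  ∀ s t : List Λ, s <+: t → t ∈ T → s ∈ T

/-- A pruned tree: every node has a proper extension in the tree. -/
def IsPruned {Λ : Type*} (T : Set (List Λ)) : Prop :=
  ∀ t ∈ T, ∃ a : Λ, t ++ [a] ∈ T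

/-- `σ` is an infinite branch of `T`. -/
def IsBranch {Λ : Type*} (T : Set (List Λ)) (σ : ℕ → Λ) : Prop :=
  ∀ n : ℕ, (List.ofFn fun i : Fin n => σ i) ∈ T

/-- `T` is ill-founded: it has an infinite branch. -/
def TreeIllFounded {Λ : Type*} (T : Set (List Λ)) : Prop :=
  ∃ σ : ℕ → Λ, IsBranch T σ

/-- The derivative of a tree: its non-maximal nodes, i.e. nodes having a proper
extension in the tree. -/
def treeDeriv {Λ : Type*} (T : Set (List Λ)) : Set (List Λ) :=
  {l | l ∈ T ∧ ∃ a : Λ, l ++ [a] ∈ T}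

/-- The iterated derivatives `T^(ξ)` of a tree, defined by transfinite recursion. -/
def treeDerivIter {Λ : Type*} (T : Set (List Λ)) (ξ : Ordinal.{0}) : Set (List Λ) :=
  Ordinal.limitRecOn ξ T (fun _ S => treeDeriv S)
    (fun o _ ih => ⋂ (o' : Ordinal.{0}) (h : o' < o), ih o' h)

/-- The ordinal rank `o(T)` of a (well-founded) tree: the least `ξ` with `T^(ξ) = ∅`. -/
def treeRank {Λ : Type*} (T : Set (List Λ)) : Ordinal.{0} :=
  sInf {ξ : Ordinal.{0} | treeDerivIter T ξ = ∅}

/-- The first uncountable ordinal `ω₁`. -/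
def omega1 : Ordinal.{0} := (Cardinal.aleph 1).ord

/-- Bourgain's tree `T(Y, (e_n), δ)`: all finite sequences `(y_0, …, y_k)` in `Y`
which are `δ`-equivalent to `(e_0, …, e_k)`. -/
def bourgainTree {W : Type*} [SeminormedAddCommGroup W] [NormedSpace ℝ W] (e : ℕ → W)
    (δ : ℝ) (Y : Type*) [SeminormedAddCommGroup Y] [NormedSpace ℝ Y] : Set (List Y) :=
  {l : List Y | ∀ a : ℕ → ℝ,
    δ * ‖∑ i ∈ Finset.range l.length, a i • e i‖ ≤
        ‖∑ i ∈ Finset.range l.length, a i • l.getD i 0‖ ∧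
    ‖∑ i ∈ Finset.range l.length, a i • l.getD i 0‖ ≤
        δ⁻¹ * ‖∑ i ∈ Finset.range l.length, a i • e i‖}

open Classical in
/-- Bourgain's ordinal index of `Y` relative to a (normalized Schauder) basis `(e_n)`
of a space `W`: it equals `ω₁` if some tree `T(Y, (e_n), δ)` is ill-founded, and
otherwise `sup_{0 < δ ≤ 1} o(T(Y, (e_n), δ))`.  With `W = C(2^ℕ)` this is `φ_NU`,
and with `W = Z` it is `φ_{NC_Z}`. -/
def bourgainIndex {W : Type*} [SeminormedAddCommGroup W] [NormedSpace ℝ W] (e : ℕ → W)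
    (Y : Type*) [SeminormedAddCommGroup Y] [NormedSpace ℝ Y] : Ordinal.{0} :=
  if ∃ δ ∈ Set.Ioc (0:ℝ) 1, TreeIllFounded (bourgainTree e δ Y) then omega1
  else ⨆ δ : Set.Ioc (0:ℝ) 1, treeRank (bourgainTree e δ.1 Y)

/-! ### The Schur property and the Radon-Nikodym property -/

/-- `X` has the Schur property: weakly convergent sequences are norm convergent. -/
def HasSchurProperty (X : Type*) [SeminormedAddCommGroup X] [NormedSpace ℝ X] : Prop :=
  ∀ (f : ℕ → X) (x : X),
    (∀ φ : X →L[ℝ] ℝ, Tendsto (fun n => φ (f n)) atTop (𝓝 (φ x))) →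
    Tendsto f atTop (𝓝 x)

/-- `X` has the Radon-Nikodym property: on every finite measure space, every
`X`-valued vector measure of bounded variation which is absolutely continuous
with respect to the measure has a Bochner-integrable density. -/
def HasRNP (X : Type*) [NormedAddCommGroup X] [NormedSpace ℝ X] : Prop :=
  ∀ (Ω : Type) [MeasurableSpace Ω] (μ : Measure Ω), IsFiniteMeasure μ →
    ∀ τ : VectorMeasure Ω X,
      (∀ s : Set Ω, MeasurableSet s → μ s = 0 → τ s = 0) →
      (∃ C : ℝ, ∀ P : Finset (Set Ω), (∀ s ∈ P, MeasurableSet s) →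
        ((P : Set (Set Ω)).Pairwise fun s t => Disjoint s t) →
        ∑ s ∈ P, ‖τ s‖ ≤ C) →
      ∃ g : Ω → X, Integrable g μ ∧
        ∀ s : Set Ω, MeasurableSet s → τ s = ∫ x in s, g x ∂μ

/-! ### `𝓛_{∞,λ}`-spaces -/

/-- The Banach-Mazur distance from `G` to `ℓ∞^n` is at most `θ`, witnessed by an
isomorphism `e` with `‖e‖ ⬝ ‖e⁻¹‖ ≤ θ'` for every `θ' > θ`. -/
def BMdistToLinftyLE (G : Type*) [SeminormedAddCommGroup G] [NormedSpace ℝ G]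
    (n : ℕ) (θ : ℝ) : Prop :=
  ∀ θ' : ℝ, θ < θ' → ∃ e : G ≃L[ℝ] (Fin n → ℝ),
    ‖(e : G →L[ℝ] (Fin n → ℝ))‖ * ‖(e.symm : (Fin n → ℝ) →L[ℝ] G)‖ ≤ θ'

/-- `X` is an (infinite-dimensional) `𝓛_{∞,λ}`-space: every finite-dimensional subspace
`F` of `X` is contained in a finite-dimensional subspace `G` with `d(G, ℓ∞^(dim G)) ≤ λ`. -/
def IsLinftyLam (lam : ℝ) (X : Type*) [NormedAddCommGroup X] [NormedSpace ℝ X] : Prop :=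
  (¬ FiniteDimensional ℝ X) ∧
  ∀ F : Submodule ℝ X, FiniteDimensional ℝ F →
    ∃ G : Submodule ℝ X, F ≤ G ∧ FiniteDimensional ℝ G ∧
      BMdistToLinftyLE G (Module.finrank ℝ G) lam

/-- `X` is an `𝓛_{∞,λ+}`-space: it is an `𝓛_{∞,θ}`-space for every `θ > λ`. -/
def IsLinftyPlus (lam : ℝ) (X : Type*) [NormedAddCommGroup X] [NormedSpace ℝ X] : Prop :=
  ∀ θ : ℝ, lam < θ → IsLinftyLam θ X

/-! ### Minimal spaces and `ℓ₁` -/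

/-- The space `ℓ₁`. -/
abbrev EllOne : Type := lp (fun _ : ℕ => ℝ) 1

/-- `X` is a minimal Banach space: it is infinite-dimensional and embeds isomorphically
into every infinite-dimensional (closed) subspace of itself. -/
def IsMinimal (X : Type*) [NormedAddCommGroup X] [NormedSpace ℝ X] : Prop :=
  (¬ FiniteDimensional ℝ X) ∧
  ∀ Z : Submodule ℝ X, IsClosed (Z : Set X) → ¬ FiniteDimensional ℝ Z → Embeds X Z

end


noncomputable section

/-! ### The Cantor basis of `C(2^ℕ)` -/

/-- The indicator function of a clopen set. -/
def indC (A : TopologicalSpace.Clopens CantorSet) : CantorC :=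
  ⟨Set.indicator (A : Set CantorSet) 1,
    A.isClopen.continuous_indicator continuous_one⟩

theorem indC_apply_mem {A : TopologicalSpace.Clopens CantorSet} {x : CantorSet} (h : x ∈ A) :
    indC A x = 1 := by
  simp only [indC, ContinuousMap.coe_mk]
  rw [Set.indicator_of_mem (show x ∈ (A : Set CantorSet) from h)]; rfl

theorem indC_apply_notMem {A : TopologicalSpace.Clopens CantorSet} {x : CantorSet} (h : x ∉ A) :
    indC A x = 0 := by
  simp only [indC, ContinuousMap.coe_mk]
  rw [Set.indicator_of_notMem (show x ∉ (A : Set CantorSet) from h)]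

theorem isClopen_coord (i : ℕ) (b : Bool) : IsClopen {x : CantorSet | x i = b} := by
  have : {x : CantorSet | x i = b} = (fun x : CantorSet => x i) ⁻¹' {b} := rfl
  rw [this]
  exact (isClopen_discrete {b}).preimage (continuous_apply i)

/-- The cylinder attached to `n`. -/
def cylD (n : ℕ) : TopologicalSpace.Clopens CantorSet :=
  ⟨{x | ∀ i < n.size, x i = n.testBit i}, by
    have : {x : CantorSet | ∀ i < n.size, x i = n.testBit i} =
        ⋂ i ∈ Finset.range n.size, {x : CantorSet | x i = n.testBit i} := by
      ext x; simp
    rw [this]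
    exact isClopen_biInter_finset fun i _ => isClopen_coord i _⟩

theorem mem_cylD {n : ℕ} {x : CantorSet} : x ∈ cylD n ↔ ∀ i < n.size, x i = n.testBit i := Iff.rfl

/-- The point attached to `n`. -/
def ptP (n : ℕ) : CantorSet := fun i => n.testBit i

theorem ptP_mem (n : ℕ) : ptP n ∈ cylD n := fun _ _ => rfl

theorem mem_cylD_zero (x : CantorSet) : x ∈ cylD 0 := by
  intro i hi; simp at hi

theorem testBit_eq_false_of_size_le {n i : ℕ} (h : n.size ≤ i) : n.testBit i = false :=
  Nat.testBit_eq_false_of_lt (Nat.size_le.1 h)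

theorem ptP_mem_iff {k n : ℕ} (hkn : k ≤ n) (h : ptP k ∈ cylD n) : k = n := by
  apply Nat.eq_of_testBit_eq
  intro i
  by_cases hi : i < n.size
  · exact h i hi
  · push Not at hi
    rw [testBit_eq_false_of_size_le hi,
      testBit_eq_false_of_size_le ((Nat.size_le_size hkn).trans hi)]

theorem cylD_lam {n j : ℕ} (hj : j ≤ n) {x : CantorSet} (hx : x ∈ cylD n) :
    x ∈ cylD j ↔ ptP n ∈ cylD j := by
  have hs := Nat.size_le_size hj
  constructor
  · intro h i hi
    rw [← h i hi]; exact (hx i (hi.trans_le hs)).symm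
  · intro h i hi
    rw [← h i hi]; exact hx i (hi.trans_le hs)

open Classical in
/-- the last `j ≤ n` with `x ∈ cylD j`. -/
def tauF (x : CantorSet) : ℕ → ℕ
  | 0 => 0
  | n + 1 => if x ∈ cylD (n + 1) then n + 1 else tauF x n

theorem tauF_le (x : CantorSet) (n : ℕ) : tauF x n ≤ n := by
  induction n with
  | zero => simp [tauF]
  | succ n ih => unfold tauF; split_ifs <;> omega

theorem mem_tauF (x : CantorSet) (n : ℕ) : x ∈ cylD (tauF x n) := by
  induction n with
  | zero => exact mem_cylD_zero x
  | succ n ih => unfold tauF; split_ifs with h; exacts [h, ih]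

theorem tauF_max (x : CantorSet) (n j : ℕ) (hj : j ≤ n) (h : x ∈ cylD j) : j ≤ tauF x n := by
  induction n with
  | zero => simp [tauF]; omega
  | succ n ih =>
    unfold tauF; split_ifs with h'
    · exact hj
    · rcases Nat.lt_or_ge j (n+1) with h1 | h1
      · exact ih (by omega)
      · have : j = n + 1 := by omega
        subst this; exact absurd h h'

theorem mem_cylD_iff_tauF (x : CantorSet) {n j : ℕ} (hj : j ≤ n) :
    x ∈ cylD j ↔ ptP (tauF x n) ∈ cylD j := by
  rcases Nat.lt_or_ge (tauF x n) j with h | h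
  · constructor
    · intro h1; have := tauF_max x n j hj h1; omega
    · intro h1; have := ptP_mem_iff h.le h1; omega
  · exact cylD_lam h (mem_tauF x n)

theorem tauF_eq {n m : ℕ} (hnm : n ≤ m) {x : CantorSet} (hx : x ∈ cylD m) :
    tauF x n = tauF (ptP m) n := by
  apply le_antisymm
  · exact tauF_max _ _ _ (tauF_le _ _)
      ((cylD_lam ((tauF_le x n).trans hnm) hx).1 (mem_tauF x n))
  · exact tauF_max _ _ _ (tauF_le _ _)
      ((cylD_lam ((tauF_le (ptP m) n).trans hnm) hx).2 (mem_tauF (ptP m) n))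

/-- The basis of `C(2^ℕ)`. -/
def eB (n : ℕ) : CantorC := indC (cylD n)

/-- The coordinate functionals. -/
def cB : ℕ → (CantorC →L[ℝ] ℝ)
  | 0 => ContinuousMap.evalCLM ℝ (ptP 0)
  | n + 1 => ContinuousMap.evalCLM ℝ (ptP (n + 1)) -
      ContinuousMap.evalCLM ℝ (ptP (tauF (ptP (n + 1)) n))

theorem cB_zero (f : CantorC) : cB 0 f = f (ptP 0) := rfl
theorem cB_succ (n : ℕ) (f : CantorC) :
    cB (n + 1) f = f (ptP (n + 1)) - f (ptP (tauF (ptP (n + 1)) n)) := rfl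

theorem abs_cB_le (n : ℕ) (f : CantorC) : |cB n f| ≤ 2 * ‖f‖ := by
  cases n with
  | zero =>
    rw [cB_zero]
    have := f.norm_coe_le_norm (ptP 0)
    rw [Real.norm_eq_abs] at this
    linarith [norm_nonneg f]
  | succ n =>
    rw [cB_succ]
    have h1 := f.norm_coe_le_norm (ptP (n+1))
    have h2 := f.norm_coe_le_norm (ptP (tauF (ptP (n + 1)) n))
    have := norm_sub_le (f (ptP (n+1))) (f (ptP (tauF (ptP (n + 1)) n)))
    rw [← Real.norm_eq_abs]
    linarith

theorem cB_eB (i j : ℕ) : cB i (eB j) = if i = j then 1 else 0 := by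
  cases i with
  | zero =>
    rw [cB_zero]
    split_ifs with h
    · subst h; exact indC_apply_mem (ptP_mem 0)
    · exact indC_apply_notMem fun h' => h (ptP_mem_iff (Nat.zero_le _) h')
  | succ n =>
    rw [cB_succ]
    have hle := tauF_le (ptP (n+1)) n
    split_ifs with h
    · subst h
      rw [eB, indC_apply_mem (ptP_mem _), indC_apply_notMem, sub_zero]
      intro h'; have := ptP_mem_iff (by omega) h'; omega
    · rcases Nat.lt_or_ge j (n+1) with h1 | h1
      · have := mem_cylD_iff_tauF (ptP (n+1)) (n := n) (j := j) (by omega)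
        by_cases h2 : ptP (n+1) ∈ cylD j
        · rw [eB, indC_apply_mem h2, indC_apply_mem (this.1 h2), sub_self]
        · rw [eB, indC_apply_notMem h2, indC_apply_notMem (fun h3 => h2 (this.2 h3)), sub_self]
      · rw [eB, indC_apply_notMem, indC_apply_notMem, sub_self]
        · intro h'; have := ptP_mem_iff (by omega) h'; omega
        · intro h'; have := ptP_mem_iff (by omega) h'; omega

/-- The partial sum projections. -/
def PB (n : ℕ) : CantorC →L[ℝ] CantorC := ∑ j ∈ Finset.range n, (cB j).smulRight (eB j)

theorem PB_apply (n : ℕ) (f : CantorC) : PB n f = ∑ j ∈ Finset.range n, cB j f • eB j := by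
  simp [PB]

theorem PB_succ (n : ℕ) (f : CantorC) : PB (n + 1) f = PB n f + cB n f • eB n := by
  rw [PB_apply, PB_apply, Finset.sum_range_succ]

theorem PB_zero (f : CantorC) : PB 0 f = 0 := by simp [PB_apply]

theorem PB_succ_apply (n : ℕ) (f : CantorC) (x : CantorSet) :
    PB (n + 1) f x = f (ptP (tauF x n)) := by
  induction n with
  | zero =>
    rw [PB_succ, PB_zero, zero_add, cB_zero]
    simp [eB, indC_apply_mem (mem_cylD_zero x), tauF]
  | succ n ih =>
    rw [PB_succ, ContinuousMap.add_apply, ih, ContinuousMap.smul_apply, cB_succ]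
    by_cases h : x ∈ cylD (n+1)
    · rw [eB, indC_apply_mem h, tauF_eq (Nat.le_succ n) h, tauF, if_pos h]
      simp
    · rw [eB, indC_apply_notMem h, tauF, if_neg h]; simp

theorem norm_PB_le (n : ℕ) (f : CantorC) : ‖PB n f‖ ≤ ‖f‖ := by
  cases n with
  | zero => rw [PB_zero]; simp
  | succ n =>
    rw [ContinuousMap.norm_le _ (norm_nonneg f)]
    intro x
    rw [PB_succ_apply]; exact f.norm_coe_le_norm _

theorem tauF_agree (x : CantorSet) {m n : ℕ} (h : 2 ^ m ≤ n) {i : ℕ} (hi : i < m) :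
    ptP (tauF x n) i = x i := by
  have key : ∀ u v : CantorSet, (∀ j < 2 ^ m, u ∈ cylD j ↔ v ∈ cylD j) →
      Nat.ofBits (fun i : Fin m => u i) ≤ Nat.ofBits (fun i : Fin m => v i) →
      u i = v i := by
    intro u v huv hle
    have hlt := Nat.ofBits_lt_two_pow (fun i : Fin m => v i)
    have hv : v ∈ cylD (Nat.ofBits (fun i : Fin m => v i)) := by
      intro k hk
      have : k < m := hk.trans_le (Nat.size_le.2 hlt)
      rw [Nat.testBit_ofBits_lt _ _ this]
    have hu := (huv _ hlt).2 hv
    have hp : ptP (Nat.ofBits (fun i : Fin m => u i)) ∈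
        cylD (Nat.ofBits (fun i : Fin m => v i)) := by
      intro k hk
      have hkm : k < m := hk.trans_le (Nat.size_le.2 hlt)
      rw [← hu k hk]
      exact Nat.testBit_ofBits_lt _ _ hkm
    have heq := ptP_mem_iff hle hp
    have h1 := Nat.testBit_ofBits_lt (fun i : Fin m => u i) i hi
    have h2 := Nat.testBit_ofBits_lt (fun i : Fin m => v i) i hi
    rw [heq, h2] at h1
    exact h1.symm
  have hiff : ∀ j < 2 ^ m, x ∈ cylD j ↔ ptP (tauF x n) ∈ cylD j := fun j hj =>
    mem_cylD_iff_tauF x (by omega)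
  rcases le_total (Nat.ofBits (fun i : Fin m => x i))
    (Nat.ofBits (fun i : Fin m => ptP (tauF x n) i)) with h1 | h1
  · exact (key _ _ hiff h1).symm
  · exact key _ _ (fun j hj => (hiff j hj).symm) h1

theorem tendsto_PB (f : CantorC) : Tendsto (fun n => PB n f) atTop (𝓝 f) := by
  rw [← tendsto_add_atTop_iff_nat 1]
  rw [ContinuousMap.tendsto_iff_tendstoUniformly]
  have hu : UniformContinuous f := CompactSpace.uniformContinuous_of_continuous f.continuous
  have hq : TendstoUniformly (fun n (x : CantorSet) => ptP (tauF x n)) id atTop := by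
    rw [tendstoUniformly_iff_tendsto, Pi.uniformity, tendsto_iInf]
    intro i
    rw [tendsto_comap_iff]
    intro V hV
    have h1 : ∀ᶠ q : ℕ × CantorSet in atTop ×ˢ ⊤, 2 ^ (i+1) ≤ q.1 :=
      (eventually_ge_atTop (2 ^ (i+1))).prod_inl _
    rw [mem_map]
    filter_upwards [h1] with q hq
    have := tauF_agree q.2 hq (Nat.lt_succ_self i)
    show (_, _) ∈ V
    simp only [id]
    rw [this]
    exact refl_mem_uniformity hV
  have := hu.comp_tendstoUniformly hq
  intro u hu
  filter_upwards [this u hu] with n hn x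
  have h2 := hn x
  simp only [PB_succ_apply]
  exact h2

end

noncomputable section

/-! ### The Banach–Mazur theorem -/

theorem banach_mazur (V : Type*) [NormedAddCommGroup V] [NormedSpace ℝ V]
    [TopologicalSpace.SeparableSpace V] : Nonempty (V →ₗᵢ[ℝ] CantorC) := by
  let K : Set (WeakDual ℝ V) := WeakDual.toStrongDual ⁻¹' Metric.closedBall 0 1
  have hK : IsCompact K := WeakDual.isCompact_closedBall 0 1
  have : CompactSpace K := isCompact_iff_compactSpace.mp hK
  have : TopologicalSpace.MetrizableSpace K := WeakDual.metrizable_of_isCompact ℝ V K hK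
  let : MetricSpace K := TopologicalSpace.metrizableSpaceMetric K
  have h0 : Nonempty K := ⟨⟨0, by simp [K]⟩⟩
  obtain ⟨p, hp, hsurj⟩ := exists_nat_bool_continuous_surjective_of_compact K
  let F : V → CantorC := fun v =>
    ⟨fun x => (p x : WeakDual ℝ V) v,
      (WeakDual.eval_continuous v).comp (continuous_subtype_val.comp hp)⟩
  have hF : ∀ v x, F v x = (p x : WeakDual ℝ V) v := fun _ _ => rfl
  refine ⟨⟨{ toFun := F, map_add' := ?_, map_smul' := ?_ }, ?_⟩⟩
  · intro u v; ext x
    rw [ContinuousMap.add_apply, hF, hF, hF]; exact map_add (p x : WeakDual ℝ V) u v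
  · intro r v; ext x
    rw [ContinuousMap.smul_apply, hF, hF]; exact map_smul (p x : WeakDual ℝ V) r v
  · intro v
    show ‖F v‖ = ‖v‖
    apply le_antisymm
    · rw [ContinuousMap.norm_le _ (norm_nonneg v)]
      intro x
      rw [hF]
      have h1 : ‖WeakDual.toStrongDual (p x : WeakDual ℝ V)‖ ≤ 1 := by
        have := (p x).2
        exact mem_closedBall_zero_iff.1 this
      have h2 := ContinuousLinearMap.le_opNorm (WeakDual.toStrongDual (p x : WeakDual ℝ V)) v
      calc _ ≤ _ := h2
        _ ≤ 1 * ‖v‖ := by gcongr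
        _ = ‖v‖ := one_mul _
    · obtain ⟨g, hg, hgv⟩ := exists_dual_vector'' ℝ v
      obtain ⟨x, hx⟩ := hsurj ⟨StrongDual.toWeakDual g, by simpa [K] using hg⟩
      have h1 := (F v).norm_coe_le_norm x
      rw [hF, hx] at h1
      have h2 : (StrongDual.toWeakDual g : WeakDual ℝ V) v = ‖v‖ := hgv
      simp only at h1
      rw [h2] at h1
      simpa using h1

/-- `ℓ₁(C(2^ℕ))`. -/
abbrev L1C : Type := lp (fun _ : ℕ => CantorC) 1

/-- The ambient space. -/
abbrev BB : Type := CantorC × L1C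

/-- The `n`-th coordinate embedding. -/
def sgl (n : ℕ) : CantorC →L[ℝ] L1C := lp.singleContinuousLinearMap ℝ (fun _ : ℕ => CantorC) 1 n

/-- The `n`-th coordinate. -/
def crd (n : ℕ) : L1C →L[ℝ] CantorC := lp.evalCLM ℝ (fun _ : ℕ => CantorC) 1 n

theorem crd_apply (n : ℕ) (z : L1C) : crd n z = z n := rfl

theorem crd_sgl (n m : ℕ) (f : CantorC) : crd n (sgl m f) = if n = m then f else 0 := by
  rw [crd_apply]
  show lp.single (E := fun _ : ℕ => CantorC) 1 m f n = _
  rw [lp.single_apply, Pi.single_apply]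

theorem norm_sgl (n : ℕ) (f : CantorC) : ‖sgl n f‖ = ‖f‖ :=
  lp.norm_single (E := fun _ : ℕ => CantorC) (by norm_num) n f

theorem L1C_ext {z w : L1C} (h : ∀ n, crd n z = crd n w) : z = w := by
  apply lp.ext; funext n; exact h n

theorem hasSum_L1C (z : L1C) : HasSum (fun n => sgl n (crd n z)) z :=
  lp.hasSum_single (by norm_num) z

theorem hasSum_norm_L1C (z : L1C) : HasSum (fun n => ‖crd n z‖) ‖z‖ := by
  have := lp.hasSum_norm (E := fun _ : ℕ => CantorC) (p := 1) (by norm_num) z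
  simp only [ENNReal.toReal_one, Real.rpow_one] at this
  exact this

theorem sum_norm_le_L1C (z : L1C) (s : Finset ℕ) : ∑ n ∈ s, ‖crd n z‖ ≤ ‖z‖ :=
  sum_le_hasSum s (fun _ _ => norm_nonneg _) (hasSum_norm_L1C z)

theorem norm_crd_le (n : ℕ) (z : L1C) : ‖crd n z‖ ≤ ‖z‖ := by
  simpa using sum_norm_le_L1C z {n}

/-- Build an element of `ℓ₁(C)`. -/
theorem exists_L1C (g : ℕ → CantorC) (h : Summable fun n => ‖g n‖) :
    ∃ z : L1C, (∀ n, crd n z = g n) ∧ ‖z‖ = ∑' n, ‖g n‖ := by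
  have hm : Memℓp g 1 := memℓp_gen (by simpa using h)
  refine ⟨⟨g, hm⟩, fun n => rfl, ?_⟩
  exact (hasSum_norm_L1C ⟨g, hm⟩).tsum_eq.symm

instance separable_L1C : TopologicalSpace.SeparableSpace L1C := by
  have h1 : TopologicalSpace.IsSeparable (⋃ n, Set.range (sgl n)) :=
    TopologicalSpace.isSeparable_iUnion.2 fun n => TopologicalSpace.isSeparable_range (sgl n).continuous
  have h2 := (h1.span (R := ℝ)).closure
  rw [← TopologicalSpace.isSeparable_univ_iff]
  refine h2.mono ?_
  intro z _
  refine mem_closure_of_tendsto (hasSum_L1C z) (Eventually.of_forall fun s => ?_)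
  refine Submodule.sum_mem _ fun n _ => Submodule.subset_span ?_
  exact Set.mem_iUnion.2 ⟨n, _, rfl⟩

/-- An isometric embedding of the ambient space. -/
theorem exists_IB : Nonempty (BB →ₗᵢ[ℝ] CantorC) := banach_mazur BB

theorem exists_theta (X : Submodule ℝ CantorC) (hX : IsClosed (X : Set CantorC)) :
    ∃ θ : ℕ → CantorC, ∀ (n : ℕ) (t : ℕ → ℝ),
      ‖∑ j ∈ Finset.range n, t j • θ j‖ =
        Metric.infDist (∑ j ∈ Finset.range n, t j • eB j) (X : Set CantorC) := by
  have : IsClosed (X : Set CantorC) := hX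
  have : TopologicalSpace.SeparableSpace (CantorC ⧸ X) :=
    (Submodule.mkQ_surjective X).denseRange.separableSpace X.mkQL.continuous
  obtain ⟨J⟩ := banach_mazur (CantorC ⧸ X)
  refine ⟨fun j => J (X.mkQ (eB j)), fun n t => ?_⟩
  have : ∑ j ∈ Finset.range n, t j • J (X.mkQ (eB j)) =
      J (X.mkQ (∑ j ∈ Finset.range n, t j • eB j)) := by
    let L : CantorC →ₗ[ℝ] CantorC := J.toLinearMap.comp X.mkQ
    have h := map_sum L (fun j => t j • eB j) (Finset.range n)
    simp only [map_smul] at h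
    exact h.symm
  rw [this, J.norm_map]
  exact QuotientAddGroup.norm_mk (S := X.toAddSubgroup) _

end

noncomputable section

/-! ### The construction -/

theorem PB_eB {l m : ℕ} (h : l < m) : PB m (eB l) = eB l := by
  rw [PB_apply, Finset.sum_eq_single l]
  · rw [cB_eB, if_pos rfl, one_smul]
  · intro j _ hj; rw [cB_eB, if_neg hj, zero_smul]
  · intro h'; exact absurd (Finset.mem_range.2 h) h'

theorem PB_PB (m : ℕ) (f : CantorC) : PB m (PB m f) = PB m f := by
  conv_lhs => rw [PB_apply m f]
  rw [map_sum, PB_apply m f]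
  refine Finset.sum_congr rfl fun j hj => ?_
  rw [map_smul, PB_eB (Finset.mem_range.1 hj)]

theorem norm_indC_le (A : TopologicalSpace.Clopens CantorSet) : ‖indC A‖ ≤ 1 := by
  rw [ContinuousMap.norm_le _ zero_le_one]
  intro x
  by_cases h : x ∈ A
  · rw [indC_apply_mem h]; simp
  · rw [indC_apply_notMem h]; simp

theorem norm_eB (n : ℕ) : ‖eB n‖ = 1 := by
  apply le_antisymm (norm_indC_le _)
  have := (eB n).norm_coe_le_norm (ptP n)
  rw [eB, indC_apply_mem (ptP_mem n)] at this
  simpa using this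

theorem tendsto_cB (f : CantorC) : Tendsto (fun n => cB n f) atTop (𝓝 0) := by
  have h1 : Tendsto (fun n => PB (n+1) f - PB n f) atTop (𝓝 (f - f)) :=
    ((tendsto_add_atTop_iff_nat 1).2 (tendsto_PB f)).sub (tendsto_PB f)
  rw [sub_self, tendsto_zero_iff_norm_tendsto_zero] at h1
  rw [tendsto_zero_iff_norm_tendsto_zero]
  refine h1.congr fun n => ?_
  rw [PB_succ, add_sub_cancel_left, norm_smul, norm_eB, mul_one]

/-- The vectors `k_n`. -/
def kV (θ : ℕ → CantorC) (n : ℕ) : BB := (eB n, sgl n (θ n))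

/-- The vectors `η_{n,i}`. -/
def etaV (n i : ℕ) : BB := (0, sgl (n+1) (eB i) - sgl n (eB i))

/-- The enumeration of the index set. -/
def stN (N : ℕ → ℕ) : ℕ → ℕ × ℕ
  | 0 => (0, 0)
  | J + 1 => if (stN N J).2 < N (stN N J).1 then ((stN N J).1, (stN N J).2 + 1)
      else ((stN N J).1 + 1, 0)

/-- The vector attached to a state. -/
def vecV (θ : ℕ → CantorC) : ℕ × ℕ → BB
  | (n, 0) => kV θ n
  | (n, l + 1) => etaV n l

/-- The basis. -/
def bV (θ : ℕ → CantorC) (N : ℕ → ℕ) (J : ℕ) : BB := vecV θ (stN N J)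

/-- `∑_{j<n} c_j(f) θ_j`. -/
def spV (θ : ℕ → CantorC) (n : ℕ) : CantorC →L[ℝ] CantorC :=
  ∑ j ∈ Finset.range n, (cB j).smulRight (θ j)

theorem spV_apply (θ : ℕ → CantorC) (n : ℕ) (f : CantorC) :
    spV θ n f = ∑ j ∈ Finset.range n, cB j f • θ j := by simp [spV]

/-- The functions `h`. -/
def hpV (θ : ℕ → CantorC) (n : ℕ) : BB →L[ℝ] CantorC :=
  (spV θ n).comp (ContinuousLinearMap.fst ℝ CantorC L1C) -
    (∑ m ∈ Finset.range n, crd m).comp (ContinuousLinearMap.snd ℝ CantorC L1C)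

theorem hpV_apply (θ : ℕ → CantorC) (n : ℕ) (y : BB) :
    hpV θ n y = spV θ n y.1 - ∑ m ∈ Finset.range n, crd m y.2 := by simp [hpV]

theorem hpV_zero (θ : ℕ → CantorC) (y : BB) : hpV θ 0 y = 0 := by
  simp [hpV_apply, spV_apply]

theorem hpV_succ (θ : ℕ → CantorC) (n : ℕ) (y : BB) :
    hpV θ (n+1) y = hpV θ n y + cB n y.1 • θ n - crd n y.2 := by
  simp only [hpV_apply, spV_apply, Finset.sum_range_succ]
  abel

theorem hpV_kV (θ : ℕ → CantorC) (n m : ℕ) : hpV θ n (kV θ m) = 0 := by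
  induction n with
  | zero => exact hpV_zero _ _
  | succ n ih =>
    rw [hpV_succ, ih, zero_add]
    simp only [kV, cB_eB, crd_sgl]
    split_ifs with h
    · subst h; simp
    · simp

theorem hpV_etaV (θ : ℕ → CantorC) (n m i : ℕ) :
    hpV θ n (etaV m i) = if n = m + 1 then eB i else 0 := by
  induction n with
  | zero => rw [hpV_zero]; simp
  | succ n ih =>
    rw [hpV_succ, ih]
    simp only [etaV, map_sub, crd_sgl, map_zero, zero_smul, add_zero]
    by_cases h1 : n = m + 1
    · subst h1; simp
    · by_cases h2 : n = m
      · subst h2; simp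
      · simp [h1, h2]

/-- Coefficient functionals. -/
def coefV (θ : ℕ → CantorC) : ℕ × ℕ → BB →L[ℝ] ℝ
  | (n, 0) => (cB n).comp (ContinuousLinearMap.fst ℝ CantorC L1C)
  | (n, l + 1) => (cB l).comp (hpV θ (n+1))

theorem coefV_vecV (θ : ℕ → CantorC) (s t : ℕ × ℕ) :
    coefV θ s (vecV θ t) = if s = t then 1 else 0 := by
  obtain ⟨n, l⟩ := s
  obtain ⟨m, i⟩ := t
  cases l with
  | zero =>
    cases i with
    | zero => simp [coefV, vecV, kV, cB_eB]
    | succ i => simp [coefV, vecV, etaV]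
  | succ l =>
    cases i with
    | zero => simp [coefV, vecV, hpV_kV]
    | succ i =>
      simp only [coefV, vecV, ContinuousLinearMap.comp_apply, hpV_etaV]
      by_cases h : n = m
      · subst h; simp [cB_eB]
      · simp [h]

theorem stN_le (N : ℕ → ℕ) (J : ℕ) : (stN N J).2 ≤ N (stN N J).1 := by
  induction J with
  | zero => simp [stN]
  | succ J ih => rw [stN]; split_ifs with h <;> simp <;> omega

theorem stN_strictMono (N : ℕ → ℕ) : StrictMono (fun J => toLex (stN N J)) := by
  apply strictMono_nat_of_lt_succ
  intro J
  rw [Prod.Lex.toLex_lt_toLex]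
  simp only [stN]
  split_ifs <;> simp

theorem stN_inj (N : ℕ → ℕ) : Function.Injective (stN N) := fun _ _ h =>
  (stN_strictMono N).injective (congrArg toLex h)

theorem stN_reach (N : ℕ → ℕ) (n : ℕ) : ∃ J, stN N J = (n, 0) := by
  induction n with
  | zero => exact ⟨0, rfl⟩
  | succ n ih =>
    obtain ⟨J, hJ⟩ := ih
    have key : ∀ i ≤ N n, stN N (J + i) = (n, i) := by
      intro i
      induction i with
      | zero => intro _; simpa using hJ
      | succ i ihi =>
        intro hi
        rw [← add_assoc, stN, ihi (by omega)]
        simp only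
        rw [if_pos (by omega)]
    refine ⟨J + N n + 1, ?_⟩
    rw [stN, key _ le_rfl]
    simp

theorem tendsto_stN (N : ℕ → ℕ) : Tendsto (fun J => (stN N J).1) atTop atTop := by
  refine tendsto_atTop_atTop_of_monotone ?_ ?_
  · apply monotone_nat_of_le_succ
    intro J
    rw [stN]; split_ifs <;> simp
  · intro n
    obtain ⟨J, hJ⟩ := stN_reach N n
    exact ⟨J, by rw [hJ]⟩

/-- The error sequence. -/
def epsS (n : ℕ) : ℝ := 1 / (16 * (n + 1) * 2 ^ n)

theorem epsS_pos (n : ℕ) : 0 < epsS n := by unfold epsS; positivity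

/-- The condition on `θ` relative to `X`. -/
def ThetaFor (X : Submodule ℝ CantorC) (θ : ℕ → CantorC) : Prop :=
  ∀ (n : ℕ) (t : ℕ → ℝ), ‖∑ j ∈ Finset.range n, t j • θ j‖ =
    Metric.infDist (∑ j ∈ Finset.range n, t j • eB j) (X : Set CantorC)

/-- The condition on `N` relative to `θ`. -/
def NFor (θ : ℕ → CantorC) (N : ℕ → ℕ) : Prop :=
  ∀ n, ∀ j ≤ n, ‖θ j - PB (N n) (θ j)‖ ≤ epsS n

/-- The closed span of the basis. -/
def YV (θ : ℕ → CantorC) (N : ℕ → ℕ) : Submodule ℝ BB :=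
  (Submodule.span ℝ (Set.range (bV θ N))).topologicalClosure

/-- The description of the closed span. -/
def WV (θ : ℕ → CantorC) (N : ℕ → ℕ) : Submodule ℝ BB where
  carrier := {y | (∀ n, PB (N n) (hpV θ (n+1) y) = hpV θ (n+1) y) ∧
    Tendsto (fun n => hpV θ n y) atTop (𝓝 0)}
  add_mem' := by
    rintro a b ⟨ha, ha'⟩ ⟨hb, hb'⟩
    refine ⟨fun n => by rw [map_add, map_add, ha, hb], ?_⟩
    simpa using ha'.add hb'
  zero_mem' := by
    refine ⟨fun n => by simp, by simp⟩
  smul_mem' := by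
    rintro r a ⟨ha, ha'⟩
    refine ⟨fun n => by rw [map_smul, map_smul, ha], ?_⟩
    simpa using ha'.const_smul r

theorem mem_WV {θ : ℕ → CantorC} {N : ℕ → ℕ} {y : BB} : y ∈ WV θ N ↔
    (∀ n, PB (N n) (hpV θ (n+1) y) = hpV θ (n+1) y) ∧
    Tendsto (fun n => hpV θ n y) atTop (𝓝 0) := Iff.rfl

theorem infDist_le_norm (X : Submodule ℝ CantorC) (f : CantorC) :
    Metric.infDist f (X : Set CantorC) ≤ ‖f‖ := by
  have := Metric.infDist_le_dist_of_mem (x := f) (s := (X : Set CantorC)) X.zero_mem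
  simpa using this

section props

variable {X : Submodule ℝ CantorC} {θ : ℕ → CantorC} (hθ : ThetaFor X θ)

include hθ

theorem norm_spV (n : ℕ) (f : CantorC) :
    ‖spV θ n f‖ = Metric.infDist (PB n f) (X : Set CantorC) := by
  rw [spV_apply, hθ n (fun j => cB j f), PB_apply]

theorem norm_spV_le (n : ℕ) (f : CantorC) : ‖spV θ n f‖ ≤ ‖f‖ := by
  rw [norm_spV hθ]
  exact (infDist_le_norm X _).trans (norm_PB_le n f)

theorem norm_hpV_le (n : ℕ) (y : BB) : ‖hpV θ n y‖ ≤ 2 * ‖y‖ := by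
  rw [hpV_apply]
  have h1 := norm_spV_le hθ n y.1
  have h2 := norm_fst_le y
  have h3 := norm_snd_le y
  have h4 := norm_sum_le (Finset.range n) (fun m => crd m y.2)
  have h5 := sum_norm_le_L1C y.2 (Finset.range n)
  have h6 := norm_sub_le (spV θ n y.1) (∑ m ∈ Finset.range n, crd m y.2)
  linarith

theorem norm_theta_le (n : ℕ) : ‖θ n‖ ≤ 1 := by
  have := norm_spV_le hθ (n+1) (eB n)
  rw [norm_eB, spV_apply, Finset.sum_range_succ, Finset.sum_eq_zero] at this
  · simpa [cB_eB] using this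
  · intro j hj
    rw [cB_eB, if_neg (Finset.mem_range.1 hj).ne, zero_smul]

theorem norm_kV_le (n : ℕ) : ‖kV θ n‖ ≤ 1 := by
  rw [kV, Prod.norm_mk, norm_eB, norm_sgl]
  exact max_le le_rfl (norm_theta_le hθ n)

theorem isClosed_WV (N : ℕ → ℕ) : IsClosed (WV θ N : Set BB) := by
  have : (WV θ N : Set BB) = (⋂ n, {y | PB (N n) (hpV θ (n+1) y) = hpV θ (n+1) y}) ∩
      {y | Tendsto (fun n => hpV θ n y) atTop (𝓝 0)} := by
    ext y; simp [mem_WV]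
  rw [this]
  refine IsClosed.inter (isClosed_iInter fun n => isClosed_eq (by fun_prop) (by fun_prop)) ?_
  rw [← closure_subset_iff_isClosed]
  intro y hy
  rw [Set.mem_ofPred_eq, Metric.tendsto_atTop]
  intro ε hε
  obtain ⟨y', hy', hd⟩ := Metric.mem_closure_iff.1 hy (ε/4) (by positivity)
  obtain ⟨n0, hn0⟩ := Metric.tendsto_atTop.1 hy' (ε/2) (by positivity)
  refine ⟨n0, fun n hn => ?_⟩
  have h1 := hn0 n hn
  have h2 := norm_hpV_le hθ n (y - y')
  rw [dist_zero_right] at h1 ⊢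
  rw [dist_eq_norm] at hd
  have h3 : hpV θ n y = hpV θ n (y - y') + hpV θ n y' := by rw [map_sub]; abel
  rw [h3]
  have := norm_add_le (hpV θ n (y - y')) (hpV θ n y')
  linarith

theorem YV_le_WV (N : ℕ → ℕ) : YV θ N ≤ WV θ N := by
  refine Submodule.topologicalClosure_minimal _ ?_ (isClosed_WV hθ N)
  rw [Submodule.span_le]
  rintro _ ⟨J, rfl⟩
  have hl := stN_le N J
  rw [bV]
  generalize stN N J = s at hl
  obtain ⟨n, l⟩ := s
  cases l with
  | zero =>
    refine ⟨fun m => ?_, ?_⟩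
    · simp [vecV, hpV_kV]
    · simp [vecV, hpV_kV]
  | succ l =>
    refine ⟨fun m => ?_, ?_⟩
    · simp only [vecV, hpV_etaV]
      split_ifs with h
      · have : m = n := by omega
        subst this
        exact PB_eB hl
      · simp
    · refine tendsto_const_nhds.congr' ?_
      filter_upwards [eventually_gt_atTop (n+1)] with m hm
      simp only [vecV, hpV_etaV]
      rw [if_neg (by omega)]

omit hθ in
/-- Partial sums, auxiliary description. -/
theorem psum_aux (N : ℕ → ℕ) (y : BB) (hy : y ∈ WV θ N) (J : ℕ) :
    ∑ j ∈ Finset.range J, coefV θ (stN N j) y • bV θ N j =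
      (PB (stN N J).1 y.1, ∑ m ∈ Finset.range (stN N J).1, sgl m (crd m y.2) +
        sgl (stN N J).1 (hpV θ (stN N J).1 y)) +
      (if (stN N J).2 = 0 then 0 else
        cB (stN N J).1 y.1 • kV θ (stN N J).1 +
        ((0 : CantorC), sgl ((stN N J).1 + 1) (PB ((stN N J).2 - 1) (hpV θ ((stN N J).1 + 1) y)) -
          sgl (stN N J).1 (PB ((stN N J).2 - 1) (hpV θ ((stN N J).1 + 1) y)))) := by
  induction J with
  | zero => simp [stN, PB_zero, hpV_zero]; rfl
  | succ J ih =>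
    have hl := stN_le N J
    rw [Finset.sum_range_succ, ih, bV, stN]
    clear ih
    generalize stN N J = s at hl
    obtain ⟨n, l⟩ := s
    simp only at hl ⊢
    -- common form
    have key : (if l = 0 then (0 : BB) else
        cB n y.1 • kV θ n +
        ((0 : CantorC), sgl (n + 1) (PB (l - 1) (hpV θ (n + 1) y)) -
          sgl n (PB (l - 1) (hpV θ (n + 1) y)))) + coefV θ (n, l) y • vecV θ (n, l) =
        cB n y.1 • kV θ n +
        ((0 : CantorC), sgl (n + 1) (PB l (hpV θ (n + 1) y)) -
          sgl n (PB l (hpV θ (n + 1) y))) := by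
      cases l with
      | zero =>
        simp [coefV, vecV, PB_zero]
      | succ l =>
        rw [if_neg (Nat.succ_ne_zero l), Nat.add_sub_cancel, PB_succ]
        simp only [coefV, vecV, etaV, ContinuousLinearMap.comp_apply]
        rw [add_assoc]
        congr 1
        ext1
        · simp
        · simp only [Prod.snd_add, Prod.smul_snd, map_add, map_smul, smul_sub]
          abel
    rw [add_assoc, key]
    by_cases h : l < N n
    · rw [if_pos h]; simp
    · rw [if_neg h]
      have hl' : l = N n := by omega
      subst hl'
      simp only [if_true, add_zero]
      rw [hy.1 n]
      have hz : crd n y.2 = hpV θ n y + cB n y.1 • θ n - hpV θ (n+1) y := by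
        rw [hpV_succ]; abel
      ext1
      · simp [kV, PB_succ]
      · simp only [Prod.snd_add, Prod.smul_snd, kV]
        rw [Finset.sum_range_succ, hz]
        simp only [map_add, map_sub, map_smul]
        abel

omit hθ in
theorem psum_main (N : ℕ → ℕ) (y : BB) (hy : y ∈ WV θ N) :
    Tendsto (fun n => ((PB n y.1, ∑ m ∈ Finset.range n, sgl m (crd m y.2) +
        sgl n (hpV θ n y)) : BB)) atTop (𝓝 y) := by
  have h1 := (hasSum_L1C y.2).tendsto_sum_nat
  have h2 : Tendsto (fun n => sgl n (hpV θ n y)) atTop (𝓝 0) := by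
    rw [tendsto_zero_iff_norm_tendsto_zero]
    simp only [norm_sgl]
    exact tendsto_zero_iff_norm_tendsto_zero.1 hy.2
  have h3 := h1.add h2
  rw [add_zero] at h3
  exact (tendsto_PB y.1).prodMk_nhds h3

omit hθ in
theorem psum_bound (N : ℕ → ℕ) (y : BB) (hy : y ∈ WV θ N) :
    Tendsto (fun n => ‖cB n y.1‖ + 2 * ‖hpV θ (n+1) y‖) atTop (𝓝 0) := by
  have h1 := tendsto_zero_iff_norm_tendsto_zero.1 (tendsto_cB y.1)
  have h2 := tendsto_zero_iff_norm_tendsto_zero.1 ((tendsto_add_atTop_iff_nat 1).2 hy.2)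
  have h3 := h1.add (h2.const_mul 2)
  rw [mul_zero, add_zero] at h3
  exact h3

theorem psum_tail (y : BB) (n l : ℕ) :
    ‖(if l = 0 then (0 : BB) else
        cB n y.1 • kV θ n +
        ((0 : CantorC), sgl (n + 1) (PB (l - 1) (hpV θ (n + 1) y)) -
          sgl n (PB (l - 1) (hpV θ (n + 1) y))))‖ ≤ ‖cB n y.1‖ + 2 * ‖hpV θ (n+1) y‖ := by
  split_ifs with h
  · rw [norm_zero]; positivity
  · refine (norm_add_le _ _).trans (add_le_add ?_ ?_)
    · rw [norm_smul]
      exact mul_le_of_le_one_right (norm_nonneg _) (norm_kV_le hθ _)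
    · rw [Prod.norm_mk, norm_zero]
      refine max_le (by positivity) ((norm_sub_le _ _).trans ?_)
      rw [norm_sgl, norm_sgl, two_mul]
      exact add_le_add (norm_PB_le _ _) (norm_PB_le _ _)

theorem psum_tendsto (N : ℕ → ℕ) (y : BB) (hy : y ∈ WV θ N) :
    Tendsto (fun J => ∑ j ∈ Finset.range J, coefV θ (stN N j) y • bV θ N j) atTop (𝓝 y) := by
  have hst := tendsto_stN N
  have h1 := (psum_main N y hy).comp hst
  have h2 := squeeze_zero_norm (fun J => psum_tail hθ y (stN N J).1 (stN N J).2)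
    ((psum_bound N y hy).comp hst)
  have h3 := h1.add h2
  rw [add_zero] at h3
  exact h3.congr fun J => (psum_aux N y hy J).symm

theorem WV_le_YV (N : ℕ → ℕ) : WV θ N ≤ YV θ N := by
  intro y hy
  refine mem_closure_of_tendsto (psum_tendsto hθ N y hy) (Eventually.of_forall fun J => ?_)
  exact Submodule.sum_mem _ fun j _ => Submodule.smul_mem _ _ (Submodule.subset_span ⟨j, rfl⟩)

theorem bV_basis (N : ℕ → ℕ) (y : BB) (hy : y ∈ YV θ N) : ∃! a : ℕ → ℝ,
    Tendsto (fun m => ∑ n ∈ Finset.range m, a n • bV θ N n) atTop (𝓝 y) := by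
  refine ⟨fun j => coefV θ (stN N j) y, psum_tendsto hθ N y (YV_le_WV hθ N hy), ?_⟩
  intro a ha
  funext i
  have h1 := ((coefV θ (stN N i)).continuous.tendsto y).comp ha
  refine tendsto_nhds_unique ?_ h1
  refine tendsto_const_nhds.congr' ?_
  filter_upwards [eventually_gt_atTop i] with m hm
  simp only [Function.comp, map_sum, map_smul, bV, coefV_vecV]
  rw [Finset.sum_eq_single i]
  · simp
  · intro j _ hj
    rw [if_neg fun h => hj (stN_inj N h).symm]; simp
  · intro h; exact absurd (Finset.mem_range.2 hm) h

/-- The distance estimate. -/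
theorem infDist_le_of_mem (N : ℕ → ℕ) (y : BB) (hy : y ∈ YV θ N) :
    Metric.infDist y.1 (X : Set CantorC) ≤ ‖y.2‖ := by
  have hw := (YV_le_WV hθ N hy).2
  have h1 : Tendsto (fun n => Metric.infDist (PB n y.1) (X : Set CantorC)) atTop
      (𝓝 (Metric.infDist y.1 (X : Set CantorC))) :=
    ((Metric.continuous_infDist_pt _).tendsto _).comp (tendsto_PB y.1)
  have h2 : Tendsto (fun n => ‖hpV θ n y‖ + ‖y.2‖) atTop (𝓝 (0 + ‖y.2‖)) :=
    (tendsto_zero_iff_norm_tendsto_zero.1 hw).add_const _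
  rw [zero_add] at h2
  refine le_of_tendsto_of_tendsto' h1 h2 fun n => ?_
  rw [← norm_spV hθ]
  have : spV θ n y.1 = hpV θ n y + ∑ m ∈ Finset.range n, crd m y.2 := by
    rw [hpV_apply]; abel
  rw [this]
  refine (norm_add_le _ _).trans ?_
  gcongr
  exact (norm_sum_le _ _).trans (sum_norm_le_L1C _ _)

theorem crd_tendsto_of_weak (N : ℕ → ℕ) (y : ℕ → BB) (hy : ∀ i, y i ∈ YV θ N)
    (hw : ∀ φ : BB →L[ℝ] ℝ, Tendsto (fun i => φ (y i)) atTop (𝓝 0)) (n : ℕ) :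
    Tendsto (fun i => crd n (y i).2) atTop (𝓝 0) := by
  have hh : ∀ n, Tendsto (fun i => hpV θ n (y i)) atTop (𝓝 0) := by
    intro n
    cases n with
    | zero => simp [hpV_zero]
    | succ n =>
      have h1 : ∀ i, hpV θ (n+1) (y i) =
          ∑ j ∈ Finset.range (N n), cB j (hpV θ (n+1) (y i)) • eB j := by
        intro i
        rw [← PB_apply]; exact ((YV_le_WV hθ N (hy i)).1 n).symm
      have h2 : Tendsto (fun i => ∑ j ∈ Finset.range (N n), cB j (hpV θ (n+1) (y i)) • eB j) atTop
          (𝓝 (∑ j ∈ Finset.range (N n), (0:ℝ) • eB j)) := by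
        refine tendsto_finsetSum _ fun j _ => Tendsto.smul_const ?_ _
        exact hw ((cB j).comp (hpV θ (n+1)))
      simp only [zero_smul, Finset.sum_const_zero] at h2
      exact h2.congr fun i => (h1 i).symm
  have hc : Tendsto (fun i => cB n (y i).1 • θ n) atTop (𝓝 ((0:ℝ) • θ n)) :=
    (hw ((cB n).comp (ContinuousLinearMap.fst ℝ CantorC L1C))).smul_const _
  have := ((hh n).add hc).sub (hh (n+1))
  simp only [zero_smul, add_zero, sub_zero] at this
  refine this.congr fun i => ?_
  rw [hpV_succ]; abel

end props

end

noncomputable section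

/-! ### The isometric copy -/

/-- The remainders `r`. -/
def rpV (θ : ℕ → CantorC) (N : ℕ → ℕ) : ℕ → CantorC →L[ℝ] CantorC
  | 0 => 0
  | m + 1 => spV θ (m+1) - (PB (N m)).comp (spV θ (m+1))

theorem rpV_succ (θ : ℕ → CantorC) (N : ℕ → ℕ) (m : ℕ) (x : CantorC) :
    rpV θ N (m+1) x = spV θ (m+1) x - PB (N m) (spV θ (m+1) x) := rfl

theorem norm_rpV_succ {θ : ℕ → CantorC} {N : ℕ → ℕ} (hN : NFor θ N) (m : ℕ) (x : CantorC) :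
    ‖rpV θ N (m+1) x‖ ≤ ‖x‖ * (1 / 8) * (1/2) ^ m := by
  have h1 : rpV θ N (m+1) x =
      ∑ j ∈ Finset.range (m+1), cB j x • (θ j - PB (N m) (θ j)) := by
    rw [rpV_succ, spV_apply, map_sum, ← Finset.sum_sub_distrib]
    refine Finset.sum_congr rfl fun j _ => ?_
    rw [map_smul, smul_sub]
  rw [h1]
  refine (norm_sum_le _ _).trans ?_
  have h2 : ∀ j ∈ Finset.range (m+1), ‖cB j x • (θ j - PB (N m) (θ j))‖ ≤
      (2 * ‖x‖) * epsS m := by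
    intro j hj
    rw [norm_smul]
    exact mul_le_mul (abs_cB_le j x) (hN m j (by have := Finset.mem_range.1 hj; omega))
      (norm_nonneg _) (by positivity)
  refine (Finset.sum_le_sum h2).trans ?_
  rw [Finset.sum_const, Finset.card_range, nsmul_eq_mul, epsS]
  have : ((m+1 : ℕ) : ℝ) * ((2 * ‖x‖) * (1 / (16 * (m + 1) * 2 ^ m))) =
      ‖x‖ * (1 / 8) * (1/2) ^ m := by
    push_cast
    rw [one_div_pow]
    field_simp
    ring
  exact this.le

theorem norm_rpV {θ : ℕ → CantorC} {N : ℕ → ℕ} (hN : NFor θ N) (m : ℕ) (x : CantorC) :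
    ‖rpV θ N m x‖ ≤ ‖x‖ * (1 / 4) * (1/2) ^ m := by
  cases m with
  | zero =>
    have : rpV θ N 0 x = 0 := rfl
    rw [this, norm_zero]; positivity
  | succ m =>
    refine (norm_rpV_succ hN m x).trans (le_of_eq ?_)
    rw [pow_succ]; ring

theorem exists_wV {θ : ℕ → CantorC} {N : ℕ → ℕ} (hN : NFor θ N) (x : CantorC) :
    ∃ z : L1C, (∀ n, crd n z = rpV θ N (n+1) x - rpV θ N n x) ∧ ‖z‖ ≤ ‖x‖ := by
  have hb : ∀ n, ‖rpV θ N (n+1) x - rpV θ N n x‖ ≤ ‖x‖ * (3/8) * (1/2)^n := by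
    intro n
    have h1 := norm_rpV_succ hN n x
    have h2 := norm_rpV hN n x
    have h3 := norm_sub_le (rpV θ N (n+1) x) (rpV θ N n x)
    linarith
  have hg : HasSum (fun n : ℕ => ‖x‖ * (3/8) * (1/2 : ℝ)^n) (‖x‖ * (3/8) * 2) :=
    hasSum_geometric_two.mul_left _
  have hs : Summable fun n => ‖rpV θ N (n+1) x - rpV θ N n x‖ :=
    Summable.of_nonneg_of_le (fun _ => norm_nonneg _) hb hg.summable
  obtain ⟨z, hz, hz'⟩ := exists_L1C _ hs
  refine ⟨z, hz, ?_⟩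
  rw [hz']
  have := hs.tsum_le_tsum hb hg.summable
  rw [hg.tsum_eq] at this
  linarith [norm_nonneg x]

theorem embed_YV {X : Submodule ℝ CantorC} {θ : ℕ → CantorC} {N : ℕ → ℕ}
    (hθ : ThetaFor X θ) (hN : NFor θ N) : Nonempty (X →ₗᵢ[ℝ] YV θ N) := by
  choose W hW hWn using fun x => exists_wV hN x
  have hmem : ∀ x : X, ((x : CantorC), W x) ∈ YV θ N := by
    intro x
    apply WV_le_YV hθ
    have hh : ∀ n, hpV θ n ((x : CantorC), W x) = spV θ n x - rpV θ N n x := by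
      intro n
      rw [hpV_apply]
      simp only [hW]
      rw [Finset.sum_range_sub (fun n => rpV θ N n (x : CantorC))]
      have : rpV θ N 0 (x : CantorC) = 0 := rfl
      rw [this, sub_zero]
    have hh' : ∀ n, hpV θ (n+1) ((x : CantorC), W x) = PB (N n) (spV θ (n+1) x) := by
      intro n
      rw [hh, rpV_succ]; abel
    rw [mem_WV]
    refine ⟨fun n => by rw [hh', PB_PB], ?_⟩
    rw [← tendsto_add_atTop_iff_nat 1]
    have h1 : Tendsto (fun n => ‖PB (n+1) (x : CantorC) - x‖) atTop (𝓝 0) := by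
      have := ((tendsto_add_atTop_iff_nat 1).2 (tendsto_PB (x : CantorC))).sub_const (x : CantorC)
      rw [sub_self] at this
      exact tendsto_zero_iff_norm_tendsto_zero.1 this
    refine squeeze_zero_norm (fun n => ?_) h1
    rw [hh']
    refine (norm_PB_le _ _).trans ?_
    rw [norm_spV hθ, ← dist_eq_norm]
    exact Metric.infDist_le_dist_of_mem x.2
  refine ⟨⟨{ toFun := fun x => ⟨((x : CantorC), W x), hmem x⟩, map_add' := ?_, map_smul' := ?_ }, ?_⟩⟩
  · intro x y
    apply Subtype.ext
    refine Prod.ext rfl (L1C_ext fun n => ?_)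
    show crd n (W (x + y : CantorC)) = crd n (W x + W y)
    rw [map_add, hW, hW, hW, map_add, map_add]; abel
  · intro r x
    apply Subtype.ext
    refine Prod.ext rfl (L1C_ext fun n => ?_)
    show crd n (W (r • x : CantorC)) = crd n (r • W x)
    rw [map_smul, hW, hW, map_smul, map_smul, smul_sub]
  · intro x
    show ‖((x : CantorC), W x)‖ = ‖(x : CantorC)‖
    rw [Prod.norm_mk]
    exact max_eq_left (hWn x)

end

noncomputable section

/-! ### Non-universality: gliding hump -/

theorem exists_disjoint_clopens (A : TopologicalSpace.Clopens CantorSet)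
    (hA : (A : Set CantorSet).Nonempty) :
    ∃ B : ℕ → TopologicalSpace.Clopens CantorSet,
      (∀ i, (B i : Set CantorSet).Nonempty) ∧ (∀ i, ∀ y ∈ B i, y ∈ A) ∧
      (∀ i, ∃ y ∈ A, y ∉ B i) ∧
      (∀ i j, i ≠ j → ∀ y, y ∈ B i → y ∉ B j) := by
  obtain ⟨x, hx⟩ := hA
  obtain ⟨m, hm⟩ := PiNat.exists_disjoint_cylinder (E := fun _ => Bool)
    (s := (A : Set CantorSet)ᶜ) A.isClopen.isOpen.isClosed_compl (x := x) (by simpa using hx)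
  rw [Set.disjoint_compl_left_iff_subset] at hm
  have hcl : ∀ i, IsClopen {y : CantorSet | (∀ k < m + i, y k = x k) ∧ y (m+i) = !x (m+i)} := by
    intro i
    have : {y : CantorSet | (∀ k < m + i, y k = x k) ∧ y (m+i) = !x (m+i)} =
        (⋂ k ∈ Finset.range (m+i), {y : CantorSet | y k = x k}) ∩ {y | y (m+i) = !x (m+i)} := by
      ext y; simp
    rw [this]
    exact (isClopen_biInter_finset fun k _ => isClopen_coord k _).inter (isClopen_coord _ _)
  refine ⟨fun i => ⟨_, hcl i⟩, ?_, ?_, ?_, ?_⟩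
  · intro i
    refine ⟨Function.update x (m+i) (!x (m+i)), ?_, ?_⟩
    · intro k hk; rw [Function.update_of_ne (by omega)]
    · simp
  · intro i y hy
    apply hm
    rw [PiNat.mem_cylinder_iff]
    intro k hk
    exact hy.1 k (by omega)
  · intro i
    refine ⟨x, hx, fun h => ?_⟩
    have := h.2
    simp at this
  · have key : ∀ i j, i < j → ∀ y : CantorSet,
        ((∀ k < m + i, y k = x k) ∧ y (m+i) = !x (m+i)) →
        ¬ ((∀ k < m + j, y k = x k) ∧ y (m+j) = !x (m+j)) := by
      intro i j hij y h1 h2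
      have := h1.2
      rw [h2.1 (m+i) (by omega)] at this
      simp at this
    intro i j hij y h1 h2
    rcases Nat.lt_or_gt_of_ne hij with h | h
    · exact key i j h y h1 h2
    · exact key j i h y h2 h1

theorem norm_sum_indC_le (B : ℕ → TopologicalSpace.Clopens CantorSet)
    (hB : ∀ i j, i ≠ j → ∀ y, y ∈ B i → y ∉ B j) (s : ℕ → ℝ) (hs : ∀ i, |s i| ≤ 1)
    (F : Finset ℕ) : ‖∑ i ∈ F, s i • indC (B i)‖ ≤ 1 := by
  rw [ContinuousMap.norm_le _ zero_le_one]
  intro x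
  rw [ContinuousMap.sum_apply]
  by_cases h : ∃ i ∈ F, x ∈ B i
  · obtain ⟨i, hi, hx⟩ := h
    rw [Finset.sum_eq_single i]
    · rw [ContinuousMap.smul_apply, indC_apply_mem hx]; simpa using hs i
    · intro j _ hj
      rw [ContinuousMap.smul_apply, indC_apply_notMem (hB i j hj.symm x hx), smul_zero]
    · intro h'; exact absurd hi h'
  · rw [Finset.sum_eq_zero]
    · simp
    · intro j hj
      rw [ContinuousMap.smul_apply, indC_apply_notMem (fun h' => h ⟨j, hj, h'⟩), smul_zero]

theorem functional_tendsto (B : ℕ → TopologicalSpace.Clopens CantorSet)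
    (hB : ∀ i j, i ≠ j → ∀ y, y ∈ B i → y ∉ B j) (ψ : CantorC →L[ℝ] ℝ) :
    Tendsto (fun i => ψ (indC (B i))) atTop (𝓝 0) := by
  have hsum : Summable fun i => ‖ψ (indC (B i))‖ := by
    refine summable_of_sum_le (c := ‖ψ‖) (fun _ => norm_nonneg _) fun F => ?_
    have h1 := norm_sum_indC_le B hB (fun i => SignType.sign (ψ (indC (B i))))
      (fun i => by
        rcases lt_trichotomy (ψ (indC (B i))) 0 with h | h | h
        · simp [sign_neg h]
        · simp [h]
        · simp [sign_pos h]) F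
    have h2 := ψ.le_opNorm_of_le h1
    rw [map_sum, mul_one] at h2
    have h3 : ∑ i ∈ F, ‖ψ (indC (B i))‖ =
        ∑ i ∈ F, ψ ((SignType.sign (ψ (indC (B i))) : ℝ) • indC (B i)) := by
      refine Finset.sum_congr rfl fun i _ => ?_
      rw [map_smul, smul_eq_mul, Real.norm_eq_abs, sign_mul_self]
    rw [h3]
    exact (Real.le_norm_self _).trans h2
  exact tendsto_zero_iff_norm_tendsto_zero.2 hsum.tendsto_atTop_zero

theorem L1C_norm_limit (S : L1C) (z : ℕ → L1C)
    (hz : ∀ n, Tendsto (fun i => crd n (z i)) atTop (𝓝 0)) :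
    Tendsto (fun i => ‖S + z i‖ - ‖z i‖) atTop (𝓝 ‖S‖) := by
  have h := tendsto_tsum_of_dominated_convergence (𝓕 := atTop)
    (f := fun i n => ‖crd n (S + z i)‖ - ‖crd n (z i)‖) (g := fun n => ‖crd n S‖)
    (bound := fun n => ‖crd n S‖) (hasSum_norm_L1C S).summable ?_ ?_
  · rw [(hasSum_norm_L1C S).tsum_eq] at h
    refine h.congr fun i => ?_
    exact ((hasSum_norm_L1C (S + z i)).sub (hasSum_norm_L1C (z i))).tsum_eq
  · intro n
    have h1 := (((hz n).const_add (crd n S)).norm).sub (hz n).norm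
    simp only [add_zero, norm_zero, sub_zero] at h1
    simpa [map_add] using h1
  · refine Eventually.of_forall fun i n => ?_
    have := abs_norm_sub_norm_le (crd n (S + z i)) (crd n (z i))
    rw [map_add, add_sub_cancel_right] at this
    rw [map_add]
    exact this

/-- Property (G). -/
theorem exists_small_clopen (T₂ : CantorC →L[ℝ] L1C)
    (hT : ∀ B : ℕ → TopologicalSpace.Clopens CantorSet,
      (∀ i j, i ≠ j → ∀ y, y ∈ B i → y ∉ B j) →
      ∀ n, Tendsto (fun i => crd n (T₂ (indC (B i)))) atTop (𝓝 0))
    (A : TopologicalSpace.Clopens CantorSet) (hA : (A : Set CantorSet).Nonempty)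
    {δ : ℝ} (hδ : 0 < δ) : ∃ B : TopologicalSpace.Clopens CantorSet,
      (B : Set CantorSet).Nonempty ∧ (∀ y ∈ B, y ∈ A) ∧ (∃ y ∈ A, y ∉ B) ∧
      ‖T₂ (indC B)‖ < δ := by
  by_contra hcon
  push Not at hcon
  obtain ⟨B, hB1, hB2, hB3, hB4⟩ := exists_disjoint_clopens A hA
  have hbig : ∀ i, δ ≤ ‖T₂ (indC (B i))‖ := fun i => hcon (B i) (hB1 i) (hB2 i) (hB3 i)
  have hcrd := hT B hB4
  have hgrow : ∀ k : ℕ, ∃ F : Finset ℕ, k * (δ/2) ≤ ‖∑ i ∈ F, T₂ (indC (B i))‖ := by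
    intro k
    induction k with
    | zero => exact ⟨∅, by simp⟩
    | succ k ih =>
      obtain ⟨F, hF⟩ := ih
      have h1 := L1C_norm_limit (∑ i ∈ F, T₂ (indC (B i))) (fun i => T₂ (indC (B i))) hcrd
      have h2 := h1.eventually (lt_mem_nhds (show ‖∑ i ∈ F, T₂ (indC (B i))‖ - δ/2 <
        ‖∑ i ∈ F, T₂ (indC (B i))‖ by linarith))
      have h3 : ∀ᶠ i in atTop, i ∉ F := by
        filter_upwards [eventually_gt_atTop (F.sup id)] with i hi hiF
        have := Finset.le_sup (f := id) hiF
        simp only [id] at this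
        omega
      obtain ⟨i, hi, hiF⟩ := (h2.and h3).exists
      refine ⟨insert i F, ?_⟩
      rw [Finset.sum_insert hiF, add_comm (T₂ (indC (B i)))]
      have := hbig i
      push_cast
      linarith
  obtain ⟨k, hk⟩ := exists_nat_gt (‖T₂‖ / (δ/2))
  obtain ⟨F, hF⟩ := hgrow k
  have h1 := norm_sum_indC_le B hB4 (fun _ => 1) (by simp) F
  have h2 := T₂.le_opNorm_of_le h1
  simp only [one_smul, map_sum, mul_one] at h2
  rw [div_lt_iff₀ (by positivity)] at hk
  linarith

end

noncomputable section

/-! ### Non-universality: the tree of clopen sets -/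

section tree

variable (G : TopologicalSpace.Clopens CantorSet → ℕ → TopologicalSpace.Clopens CantorSet)
  (A0 : TopologicalSpace.Clopens CantorSet)

/-- The cell attached to a finite sequence. -/
def cellT (σ : CantorSet) : ℕ → TopologicalSpace.Clopens CantorSet
  | 0 => A0
  | n + 1 => if σ n = true then G (cellT σ n) n else cellT σ n \ G (cellT σ n) n

open Classical in
/-- The cell containing a point. -/
def pathT (x : CantorSet) : ℕ → TopologicalSpace.Clopens CantorSet
  | 0 => A0
  | n + 1 => if x ∈ G (pathT x n) n then G (pathT x n) n else pathT x n \ G (pathT x n) n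

open Classical in
/-- The itinerary of a point. -/
def itinT (x : CantorSet) : CantorSet := fun n => decide (x ∈ G (pathT G A0 x n) n)

theorem pathT_eq_cellT (x : CantorSet) (n : ℕ) : pathT G A0 x n = cellT G A0 (itinT G A0 x) n := by
  induction n with
  | zero => rfl
  | succ n ih =>
    rw [pathT, cellT, ← ih]
    have hi : itinT G A0 x n = true ↔ x ∈ G (pathT G A0 x n) n := by
      classical
      unfold itinT; exact decide_eq_true_iff
    by_cases h : x ∈ G (pathT G A0 x n) n
    · rw [if_pos h, if_pos (hi.2 h)]
    · rw [if_neg h, if_neg (fun h' => h (hi.1 h'))]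

theorem cellT_congr {σ τ : CantorSet} {n : ℕ} (h : ∀ i < n, σ i = τ i) :
    cellT G A0 σ n = cellT G A0 τ n := by
  induction n with
  | zero => rfl
  | succ n ih =>
    rw [cellT, cellT, ih fun i hi => h i (by omega), h n (by omega)]

theorem mem_sdiff_clopens {A B : TopologicalSpace.Clopens CantorSet} {x : CantorSet} :
    x ∈ A \ B ↔ x ∈ A ∧ x ∉ B := by
  rw [← SetLike.mem_coe, TopologicalSpace.Clopens.coe_sdiff]; exact Iff.rfl

theorem mem_pathT {x : CantorSet} (hx : x ∈ A0) (n : ℕ) : x ∈ pathT G A0 x n := by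
  induction n with
  | zero => exact hx
  | succ n ih =>
    rw [pathT]
    split_ifs with h
    · exact h
    · exact mem_sdiff_clopens.2 ⟨ih, h⟩

theorem pathT_locConst (n : ℕ) (x : CantorSet) : ∀ᶠ y in 𝓝 x, pathT G A0 y n = pathT G A0 x n := by
  induction n with
  | zero => exact Eventually.of_forall fun _ => rfl
  | succ n ih =>
    by_cases h : x ∈ G (pathT G A0 x n) n
    · filter_upwards [ih, (G (pathT G A0 x n) n).isClopen.isOpen.mem_nhds h] with y h1 h2
      have h2' : y ∈ G (pathT G A0 x n) n := h2
      rw [pathT, pathT, h1, if_pos h, if_pos h2']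
    · filter_upwards [ih, (G (pathT G A0 x n) n).isClopen.isClosed.isOpen_compl.mem_nhds h]
        with y h1 h2
      have h2' : y ∉ G (pathT G A0 x n) n := h2
      rw [pathT, pathT, h1, if_neg h, if_neg h2']

theorem itinT_continuous : Continuous (itinT G A0) := by
  refine continuous_pi fun n => ?_
  refine IsLocallyConstant.continuous ((IsLocallyConstant.iff_eventually_eq _).2 fun x => ?_)
  by_cases h : x ∈ G (pathT G A0 x n) n
  · filter_upwards [pathT_locConst G A0 n x, (G (pathT G A0 x n) n).isClopen.isOpen.mem_nhds h]
      with y h1 h2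
    have h2' : y ∈ G (pathT G A0 x n) n := h2
    simp only [itinT, h1, h, h2']
  · filter_upwards [pathT_locConst G A0 n x,
      (G (pathT G A0 x n) n).isClopen.isClosed.isOpen_compl.mem_nhds h] with y h1 h2
    have h2' : y ∉ G (pathT G A0 x n) n := h2
    simp only [itinT, h1, h, h2']

variable (hA0 : (A0 : Set CantorSet).Nonempty)
  (hG1 : ∀ (A : TopologicalSpace.Clopens CantorSet) (n : ℕ), (A : Set CantorSet).Nonempty → (G A n : Set CantorSet).Nonempty)
  (hG2 : ∀ (A : TopologicalSpace.Clopens CantorSet) (n : ℕ), (A : Set CantorSet).Nonempty → ∀ y ∈ G A n, y ∈ A)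
  (hG3 : ∀ (A : TopologicalSpace.Clopens CantorSet) (n : ℕ), (A : Set CantorSet).Nonempty → ∃ y ∈ A, y ∉ G A n)

include hA0 hG1 hG3 in
theorem cellT_nonempty (σ : CantorSet) (n : ℕ) : (cellT G A0 σ n : Set CantorSet).Nonempty := by
  induction n with
  | zero => exact hA0
  | succ n ih =>
    rw [cellT]
    split_ifs with h
    · exact hG1 _ _ ih
    · obtain ⟨y, h1, h2⟩ := hG3 _ n ih
      exact ⟨y, mem_sdiff_clopens.2 ⟨h1, h2⟩⟩

include hA0 hG1 hG2 hG3

theorem cellT_anti (σ : CantorSet) (n : ℕ) {y : CantorSet} (hy : y ∈ cellT G A0 σ (n+1)) :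
    y ∈ cellT G A0 σ n := by
  rw [cellT] at hy
  split_ifs at hy with h
  · exact hG2 _ _ (cellT_nonempty G A0 hA0 hG1 hG3 σ n) y hy
  · exact (mem_sdiff_clopens.1 hy).1

theorem mem_cellT_iff (σ : CantorSet) (m : ℕ) (x : CantorSet) :
    x ∈ cellT G A0 σ m ↔ x ∈ A0 ∧ ∀ i < m, itinT G A0 x i = σ i := by
  constructor
  · intro hx
    induction m with
    | zero => exact ⟨hx, fun i hi => by omega⟩
    | succ m ih =>
      obtain ⟨h1, h2⟩ := ih (cellT_anti G A0 hA0 hG1 hG2 hG3 σ m hx)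
      refine ⟨h1, fun i hi => ?_⟩
      rcases Nat.lt_succ_iff_lt_or_eq.1 hi with h | h
      · exact h2 i h
      · subst h
        have hc : cellT G A0 σ i = pathT G A0 x i := by
          rw [pathT_eq_cellT]; exact (cellT_congr G A0 h2).symm
        rw [cellT, hc] at hx
        unfold itinT
        split_ifs at hx with h
        · rw [h]; simpa using hx
        · have h' : σ i = false := by simpa using h
          rw [h']
          simpa using (mem_sdiff_clopens.1 hx).2
  · rintro ⟨h1, h2⟩
    rw [← cellT_congr G A0 h2, ← pathT_eq_cellT]
    exact mem_pathT G A0 h1 m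

theorem itinT_surj (σ : CantorSet) : ∃ x ∈ A0, itinT G A0 x = σ := by
  obtain ⟨x, hx⟩ := IsCompact.nonempty_iInter_of_sequence_nonempty_isCompact_isClosed
    (fun n => (cellT G A0 σ n : Set CantorSet))
    (fun n y hy => cellT_anti G A0 hA0 hG1 hG2 hG3 σ n hy)
    (cellT_nonempty G A0 hA0 hG1 hG3 σ) (cellT G A0 σ 0).isClopen.isClosed.isCompact
    (fun n => (cellT G A0 σ n).isClopen.isClosed)
  rw [Set.mem_iInter] at hx
  have h := fun n => (mem_cellT_iff G A0 hA0 hG1 hG2 hG3 σ n x).1 (hx n)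
  exact ⟨x, (h 0).1, funext fun i => (h (i+1)).2 i (by omega)⟩

theorem exists_EI : ∃ E : CantorC →ₗᵢ[ℝ] CantorC,
    ∀ j, E (eB j) = indC (cellT G A0 (ptP j) j.size) := by
  let F : CantorC → CantorC := fun f => indC A0 * f.comp ⟨itinT G A0, itinT_continuous G A0⟩
  have hF1 : ∀ f x, x ∈ A0 → F f x = f (itinT G A0 x) := by
    intro f x hx
    simp only [F, ContinuousMap.mul_apply, indC_apply_mem hx, one_mul]; rfl
  have hF2 : ∀ f x, x ∉ A0 → F f x = 0 := by
    intro f x hx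
    simp only [F, ContinuousMap.mul_apply, indC_apply_notMem hx, zero_mul]
  refine ⟨⟨{ toFun := F, map_add' := ?_, map_smul' := ?_ }, ?_⟩, ?_⟩
  · intro f g; ext x
    by_cases hx : x ∈ A0
    · simp [hF1 _ _ hx]
    · simp [hF2 _ _ hx]
  · intro r f; ext x
    by_cases hx : x ∈ A0
    · simp [hF1 _ _ hx]
    · simp [hF2 _ _ hx]
  · intro f
    show ‖F f‖ = ‖f‖
    apply le_antisymm
    · rw [ContinuousMap.norm_le _ (norm_nonneg f)]
      intro x
      by_cases hx : x ∈ A0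
      · rw [hF1 _ _ hx]; exact f.norm_coe_le_norm _
      · rw [hF2 _ _ hx]; simp
    · rw [ContinuousMap.norm_le _ (norm_nonneg _)]
      intro σ
      obtain ⟨x, hx, rfl⟩ := itinT_surj G A0 hA0 hG1 hG2 hG3 σ
      rw [← hF1 f x hx]
      exact (F f).norm_coe_le_norm x
  · intro j
    show F (eB j) = _
    ext x
    have hm := mem_cellT_iff G A0 hA0 hG1 hG2 hG3 (ptP j) j.size x
    by_cases hx : x ∈ A0
    · rw [hF1 _ _ hx]
      by_cases h : itinT G A0 x ∈ cylD j
      · rw [eB, indC_apply_mem h, indC_apply_mem (hm.2 ⟨hx, h⟩)]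
      · rw [eB, indC_apply_notMem h, indC_apply_notMem fun h' => h (hm.1 h').2]
    · rw [hF2 _ _ hx, indC_apply_notMem fun h' => hx (hm.1 h').1]

end tree

theorem testBit_size_pred {j n : ℕ} (h : j.size = n + 1) : j.testBit n = true := by
  by_contra hc
  have hc' : j.testBit n = false := by simpa using hc
  have h1 : j < 2 ^ (n+1) := Nat.size_le.1 h.le
  have h2 : ¬ j < 2 ^ n := fun h3 => by have := Nat.size_le.2 h3; omega
  have : j < 2 ^ n := by
    apply Nat.lt_pow_two_of_testBit
    intro i hi
    rcases Nat.eq_or_lt_of_le hi with h4 | h4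
    · rw [← h4]; exact hc'
    · exact Nat.testBit_eq_false_of_lt (h1.trans_le (Nat.pow_le_pow_right (by norm_num) h4))
  exact h2 this

/-- Given property (G), small images of a reproduced basis. -/
theorem exists_EI_small (T₂ : CantorC →L[ℝ] L1C)
    (hT : ∀ B : ℕ → TopologicalSpace.Clopens CantorSet,
      (∀ i j, i ≠ j → ∀ y, y ∈ B i → y ∉ B j) →
      ∀ n, Tendsto (fun i => crd n (T₂ (indC (B i)))) atTop (𝓝 0))
    (δ : ℕ → ℝ) (hδ : ∀ j, 0 < δ j) (hanti : Antitone δ) :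
    ∃ E : CantorC →ₗᵢ[ℝ] CantorC, ∀ j, ‖T₂ (E (eB j))‖ < δ j := by
  have hex := fun (A : TopologicalSpace.Clopens CantorSet) (n : ℕ)
    (hA : (A : Set CantorSet).Nonempty) => exists_small_clopen T₂ hT A hA (hδ (2 ^ (n+1)))
  have hex' : ∀ (A : TopologicalSpace.Clopens CantorSet) (n : ℕ),
      ∃ B : TopologicalSpace.Clopens CantorSet, (A : Set CantorSet).Nonempty →
      (B : Set CantorSet).Nonempty ∧ (∀ y ∈ B, y ∈ A) ∧ (∃ y ∈ A, y ∉ B) ∧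
      ‖T₂ (indC B)‖ < δ (2 ^ (n+1)) := by
    intro A n
    by_cases hA : (A : Set CantorSet).Nonempty
    · obtain ⟨B, hB⟩ := hex A n hA
      exact ⟨B, fun _ => hB⟩
    · exact ⟨A, fun h => absurd h hA⟩
  choose G hG using hex'
  obtain ⟨A0, hA0, -, -, hA0'⟩ := exists_small_clopen T₂ hT ⊤ ⟨fun _ => true, trivial⟩ (hδ 0)
  obtain ⟨E, hE⟩ := exists_EI G A0 hA0 (fun A n hA => (hG A n hA).1)
    (fun A n hA => (hG A n hA).2.1) (fun A n hA => (hG A n hA).2.2.1)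
  refine ⟨E, fun j => ?_⟩
  rw [hE]
  have hne := cellT_nonempty G A0 hA0 (fun A n hA => (hG A n hA).1)
    (fun A n hA => (hG A n hA).2.2.1) (ptP j)
  rcases hs : j.size with _ | n
  · have : j = 0 := Nat.size_eq_zero.1 hs
    subst this
    exact hA0'
  · rw [cellT, if_pos (show ptP j n = true from testBit_size_pred hs)]
    refine (hG _ n (hne n)).2.2.2.trans_le (hanti ?_)
    exact (Nat.size_le.1 hs.le).le

theorem small_second (U : CantorC →L[ℝ] L1C) (δ : ℕ → ℝ) (c : ℝ) (hδ : ∀ j, 0 < δ j)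
    (hsum : HasSum (fun j => 2 * δ j) (c/2)) (hU : ∀ j, ‖U (eB j)‖ ≤ δ j) (f : CantorC) :
    ‖U f‖ ≤ c/2 * ‖f‖ := by
  have h1 : Tendsto (fun n => ‖U (PB n f)‖) atTop (𝓝 ‖U f‖) :=
    (U.continuous.norm.tendsto f).comp (tendsto_PB f)
  refine le_of_tendsto' h1 fun n => ?_
  rw [PB_apply, map_sum]
  refine (norm_sum_le _ _).trans ?_
  have h2 : ∀ j ∈ Finset.range n, ‖U (cB j f • eB j)‖ ≤ (2 * δ j) * ‖f‖ := by
    intro j _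
    rw [map_smul, norm_smul]
    have := mul_le_mul (abs_cB_le j f) (hU j) (norm_nonneg _) (by positivity)
    calc _ ≤ _ := this
      _ = _ := by ring
  refine (Finset.sum_le_sum h2).trans ?_
  rw [← Finset.sum_mul]
  refine mul_le_mul_of_nonneg_right ?_ (norm_nonneg f)
  exact sum_le_hasSum _ (fun j _ => by have := hδ j; positivity) hsum

theorem exists_perturb_gen {E : Type*} [NormedAddCommGroup E] [NormedSpace ℝ E] [CompleteSpace E]
    (ψ : ℕ → E →L[ℝ] ℝ) (e : ℕ → E) (hψ : ∀ j x, |ψ j x| ≤ 2 * ‖x‖)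
    (hψe : ∀ j k, ψ j (e k) = if j = k then 1 else 0) (v : ℕ → E) (δ : ℕ → ℝ) (c : ℝ)
    (hδ : ∀ j, 0 < δ j)
    (hsum : HasSum (fun j => 2 * δ j) (c/2)) (hv : ∀ j, ‖v j‖ ≤ δ j) :
    ∃ V : E →L[ℝ] E, ‖V‖ ≤ c/2 ∧ ∀ k, V (e k) = v k := by
  have hWn : ∀ j, ‖(ψ j).smulRight (v j)‖ ≤ 2 * δ j := by
    intro j
    refine ContinuousLinearMap.opNorm_le_bound _ (by have := hδ j; positivity) fun f => ?_
    rw [ContinuousLinearMap.smulRight_apply, norm_smul]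
    have := mul_le_mul (hψ j f) (hv j) (norm_nonneg _) (by positivity)
    calc _ ≤ _ := this
      _ = _ := by ring
  have hWs : Summable fun j => (ψ j).smulRight (v j) :=
    Summable.of_norm_bounded hsum.summable hWn
  refine ⟨∑' j, (ψ j).smulRight (v j), tsum_of_norm_bounded hsum hWn, fun k => ?_⟩
  have h1 := (ContinuousLinearMap.apply ℝ E (e k)).hasSum hWs.hasSum
  have h2 : HasSum (fun j => ψ j (e k) • v j) (v k) := by
    have h3 : ψ k (e k) • v k = v k := by
      rw [hψe, if_pos rfl, one_smul]
    have h4 := hasSum_single (f := fun j => ψ j (e k) • v j) k fun j hj => by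
      rw [hψe, if_neg hj, zero_smul]
    rwa [h3] at h4
  exact h1.unique h2

theorem exists_perturb (v : ℕ → CantorC) (δ : ℕ → ℝ) (c : ℝ) (hδ : ∀ j, 0 < δ j)
    (hsum : HasSum (fun j => 2 * δ j) (c/2)) (hv : ∀ j, ‖v j‖ ≤ δ j) :
    ∃ V : CantorC →L[ℝ] CantorC, ‖V‖ ≤ c/2 ∧ ∀ k, V (eB k) = v k :=
  exists_perturb_gen cB eB abs_cB_le cB_eB v δ c hδ hsum hv

theorem perturb_embed (X : Submodule ℝ CantorC) (hX : IsClosed (X : Set CantorC))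
    (S1 : CantorC →L[ℝ] CantorC) (δ : ℕ → ℝ) (c : ℝ) (hc : 0 < c) (hδ : ∀ j, 0 < δ j)
    (hsum : HasSum (fun j => 2 * δ j) (c/2)) (hlow : ∀ f, c * ‖f‖ ≤ ‖S1 f‖)
    (x : ℕ → CantorC) (hxX : ∀ j, x j ∈ X) (hxd : ∀ j, ‖x j - S1 (eB j)‖ ≤ δ j) :
    Embeds CantorC X := by
  obtain ⟨V, hVn, hVe⟩ := exists_perturb (fun j => x j - S1 (eB j)) δ c hδ hsum hxd
  have hSe : ∀ k, (S1 + V) (eB k) ∈ X := by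
    intro k
    rw [add_apply, hVe, add_sub_cancel]
    exact hxX k
  have hSX : ∀ f, (S1 + V) f ∈ X := by
    intro f
    refine hX.mem_of_tendsto (((S1 + V).continuous.tendsto f).comp (tendsto_PB f))
      (Eventually.of_forall fun n => ?_)
    show (S1 + V) (PB n f) ∈ X
    rw [PB_apply, map_sum]
    refine Submodule.sum_mem _ fun j _ => ?_
    rw [map_smul]
    exact X.smul_mem _ (hSe j)
  refine ⟨(S1 + V).codRestrict X hSX, c/2, by positivity, fun f => ?_⟩
  show c/2 * ‖f‖ ≤ ‖S1 f + V f‖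
  have h1 := hlow f
  have h2 := V.le_of_opNorm_le hVn f
  have h3 := norm_sub_norm_le (S1 f) (-V f)
  rw [norm_neg, sub_neg_eq_add] at h3
  linarith

/-- Universality passes to `X`. -/
theorem embeds_of_embeds (X : Submodule ℝ CantorC) (hX : IsClosed (X : Set CantorC))
    (T₁ : CantorC →L[ℝ] CantorC) (T₂ : CantorC →L[ℝ] L1C)
    (c : ℝ) (hc : 0 < c) (hTc : ∀ g, c * ‖g‖ ≤ max ‖T₁ g‖ ‖T₂ g‖)
    (hd : ∀ g, Metric.infDist (T₁ g) (X : Set CantorC) ≤ ‖T₂ g‖)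
    (hT : ∀ B : ℕ → TopologicalSpace.Clopens CantorSet,
      (∀ i j, i ≠ j → ∀ y, y ∈ B i → y ∉ B j) →
      ∀ n, Tendsto (fun i => crd n (T₂ (indC (B i)))) atTop (𝓝 0)) :
    Embeds CantorC X := by
  obtain ⟨δ, hδ, hanti, hsum⟩ : ∃ δ : ℕ → ℝ, (∀ j, 0 < δ j) ∧ Antitone δ ∧
      HasSum (fun j => 2 * δ j) (c/2) := by
    refine ⟨fun j => c / 8 * (1/2) ^ j, fun j => by positivity, ?_, ?_⟩
    · intro i j hij
      have := pow_le_pow_of_le_one (show (0:ℝ) ≤ 1/2 by norm_num) (by norm_num) hij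
      exact mul_le_mul_of_nonneg_left this (by positivity)
    · have := (hasSum_geometric_two.mul_left (c/8)).mul_left 2
      have h2 : 2 * (c / 8 * 2) = c / 2 := by ring
      rwa [h2] at this
  obtain ⟨E, hE⟩ := exists_EI_small T₂ hT δ hδ hanti
  have hsmall : ∀ f, ‖T₂ (E f)‖ ≤ c/2 * ‖f‖ :=
    small_second (T₂.comp E.toContinuousLinearMap) δ c hδ hsum fun j => (hE j).le
  have hlow : ∀ f, c * ‖f‖ ≤ ‖T₁ (E f)‖ := by
    intro f
    by_cases hf : f = 0
    · subst hf; simp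
    have hfp : 0 < ‖f‖ := norm_pos_iff.2 hf
    have h1 := hTc (E f)
    rw [E.norm_map] at h1
    rcases le_max_iff.1 h1 with h | h
    · exact h
    · have := hsmall f
      nlinarith
  have hx : ∀ j, ∃ x ∈ X, ‖x - T₁ (E (eB j))‖ < δ j := by
    intro j
    have h1 : Metric.infDist (T₁ (E (eB j))) (X : Set CantorC) < δ j :=
      (hd (E (eB j))).trans_lt (hE j)
    obtain ⟨x, hx, hx'⟩ := (Metric.infDist_lt_iff ⟨0, X.zero_mem⟩).1 h1
    refine ⟨x, hx, ?_⟩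
    rwa [dist_comm, dist_eq_norm] at hx'
  choose x hxX hxd using hx
  exact perturb_embed X hX (T₁.comp E.toContinuousLinearMap) δ c hc hδ hsum hlow x hxX
    fun j => (hxd j).le

theorem not_embeds_YV {X : Submodule ℝ CantorC} (hX : IsClosed (X : Set CantorC))
    {θ : ℕ → CantorC} {N : ℕ → ℕ} (hθ : ThetaFor X θ) (hU : ¬ Embeds CantorC X) :
    ¬ Embeds CantorC (YV θ N) := by
  rintro ⟨T, c, hc, hT⟩
  apply hU
  refine embeds_of_embeds X hX
    ((ContinuousLinearMap.fst ℝ CantorC L1C).comp ((YV θ N).subtypeL.comp T))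
    ((ContinuousLinearMap.snd ℝ CantorC L1C).comp ((YV θ N).subtypeL.comp T)) c hc hT ?_ ?_
  · intro g
    exact infDist_le_of_mem hθ N _ (T g).2
  · intro B hB n
    refine crd_tendsto_of_weak hθ N (fun i => ((YV θ N).subtypeL.comp T) (indC (B i)))
      (fun i => (T _).2) (fun φ => ?_) n
    exact functional_tendsto B hB (φ.comp ((YV θ N).subtypeL.comp T))

end

noncomputable section

/-! ### Measurability and the final construction -/

theorem measurable_infDist_SB (a : CantorC) :
    Measurable fun Y : SB => Metric.infDist a (Y.1 : Set CantorC) := by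
  refine measurable_of_Iio fun r => ?_
  apply MeasurableSpace.measurableSet_generateFrom
  refine ⟨Metric.ball a r, Metric.isOpen_ball, ?_⟩
  ext Y
  show Metric.infDist a (Y.1 : Set CantorC) < r ↔ _
  rw [Metric.infDist_lt_iff ⟨0, Y.1.zero_mem⟩]
  constructor
  · rintro ⟨y, hy, h⟩
    exact ⟨y, hy, by rwa [Metric.mem_ball, dist_comm]⟩
  · rintro ⟨y, hy, h⟩
    exact ⟨y, hy, by rwa [Metric.mem_ball, dist_comm] at h⟩

theorem continuous_evalN : Continuous fun p : (ℕ → ℕ) × ℕ => p.1 p.2 :=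
  continuous_prod_of_discrete_right.2 fun k => continuous_apply k

theorem continuous_stN (J : ℕ) : Continuous fun N : ℕ → ℕ => stN N J := by
  induction J with
  | zero => exact continuous_const
  | succ J ih =>
    have h : Continuous fun N : ℕ → ℕ => (stN N J, N (stN N J).1) :=
      ih.prodMk (continuous_evalN.comp (continuous_id.prodMk (continuous_fst.comp ih)))
    exact (continuous_of_discreteTopology (f := fun p : (ℕ × ℕ) × ℕ =>
      if p.1.2 < p.2 then (p.1.1, p.1.2 + 1) else (p.1.1 + 1, 0))).comp h

theorem continuous_vecV : Continuous fun p : (ℕ → CantorC) × (ℕ × ℕ) => vecV p.1 p.2 := by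
  refine continuous_prod_of_discrete_right.2 fun s => ?_
  obtain ⟨n, l⟩ := s
  cases l with
  | zero =>
    show Continuous fun θ : ℕ → CantorC => (eB n, sgl n (θ n))
    exact continuous_const.prodMk ((sgl n).continuous.comp (continuous_apply n))
  | succ l => exact continuous_const

theorem continuous_bV (J : ℕ) :
    Continuous fun p : (ℕ → CantorC) × (ℕ → ℕ) => bV p.1 p.2 J :=
  continuous_vecV.comp (continuous_fst.prodMk ((continuous_stN J).comp continuous_snd))

theorem denseRange_ratVec (n : ℕ) : DenseRange fun (q : Fin n → ℚ) (i : Fin n) => (q i : ℝ) :=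
  DenseRange.piMap fun _ => Rat.denseRange_cast

/-- Rational version of `ThetaFor`. -/
def ThetaQ (X : Submodule ℝ CantorC) (θ : ℕ → CantorC) : Prop :=
  ∀ (n : ℕ) (q : Fin n → ℚ), ‖∑ j : Fin n, (q j : ℝ) • θ j‖ =
    Metric.infDist (∑ j : Fin n, (q j : ℝ) • eB j) (X : Set CantorC)

theorem thetaFor_of_thetaQ {X : Submodule ℝ CantorC} {θ : ℕ → CantorC} (h : ThetaQ X θ) :
    ThetaFor X θ := by
  intro n t
  have hc : ∀ w : ℕ → CantorC, Continuous fun t : Fin n → ℝ => ∑ j : Fin n, t j • w j :=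
    fun w => continuous_finsetSum _ fun j _ => (continuous_apply j).smul continuous_const
  have hc1 : Continuous fun t : Fin n → ℝ => ‖∑ j : Fin n, t j • θ j‖ := (hc θ).norm
  have hc2 : Continuous fun t : Fin n → ℝ =>
      Metric.infDist (∑ j : Fin n, t j • eB j) (X : Set CantorC) :=
    (Metric.continuous_infDist_pt (X : Set CantorC)).comp (hc eB)
  have := (denseRange_ratVec n).equalizer hc1 hc2 (funext fun q => h n q)
  have h2 := congrFun this fun j => t j
  rw [Finset.sum_range, Finset.sum_range]
  exact h2

theorem thetaQ_of_thetaFor {X : Submodule ℝ CantorC} {θ : ℕ → CantorC} (h : ThetaFor X θ) :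
    ThetaQ X θ := by
  intro n q
  have := h n fun j => if hj : j < n then (q ⟨j, hj⟩ : ℝ) else 0
  rw [Finset.sum_range, Finset.sum_range] at this
  simpa using this

theorem exists_NFor (θ : ℕ → CantorC) : ∃ N, NFor θ N := by
  have : ∀ n, ∃ M, ∀ j ≤ n, ‖θ j - PB M (θ j)‖ ≤ epsS n := by
    intro n
    have h : ∀ᶠ M in atTop, ∀ j ∈ Set.Iic n, ‖θ j - PB M (θ j)‖ ≤ epsS n := by
      rw [Filter.eventually_all_finite (Set.finite_Iic n)]
      intro j _
      filter_upwards [(Metric.tendsto_nhds.1 (tendsto_PB (θ j))) (epsS n) (epsS_pos n)] with M hM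
      rw [dist_comm, dist_eq_norm] at hM
      exact hM.le
    exact h.exists
  choose N hN using this
  exact ⟨N, hN⟩

/-- The coding relation. -/
def relR (f : (ℕ → ℕ) → SB) : Set ((ℕ → ℕ) × ((ℕ → CantorC) × (ℕ → ℕ))) :=
  {p | ThetaQ (f p.1).1 p.2.1 ∧ NFor p.2.1 p.2.2}

theorem continuous_NFor_aux (n j : ℕ) :
    Continuous fun p : (ℕ → CantorC) × (ℕ → ℕ) => ‖p.1 j - PB (p.2 n) (p.1 j)‖ := by
  have h : Continuous fun p : CantorC × ℕ => PB p.2 p.1 :=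
    continuous_prod_of_discrete_right.2 fun k => (PB k).continuous
  have h1 : Continuous fun p : (ℕ → CantorC) × (ℕ → ℕ) => p.1 j :=
    (continuous_apply j).comp continuous_fst
  have h2 : Continuous fun p : (ℕ → CantorC) × (ℕ → ℕ) => p.2 n :=
    (continuous_apply n).comp continuous_snd
  exact (h1.sub (h.comp (h1.prodMk h2))).norm

theorem relR_analytic (f : (ℕ → ℕ) → SB) (hf : Measurable f) : AnalyticSet (relR f) := by
  let _ : MeasurableSpace CantorC := borel CantorC
  have : BorelSpace CantorC := ⟨rfl⟩
  have hsc : SecondCountableTopology CantorC := inferInstance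
  have hP : PolishSpace CantorC := inferInstance
  have hsc1 : SecondCountableTopology (ℕ → CantorC) := inferInstance
  have hB1 : BorelSpace (ℕ → CantorC) := Pi.borelSpace
  have hB3 : BorelSpace (ℕ → ℕ) := Pi.borelSpace
  have hB2 : BorelSpace ((ℕ → CantorC) × (ℕ → ℕ)) := Prod.borelSpace
  have hB4 : BorelSpace ((ℕ → ℕ) × (ℕ → CantorC) × (ℕ → ℕ)) := Prod.borelSpace
  have hP1 : PolishSpace (ℕ → CantorC) := inferInstance
  have hP2 : PolishSpace (ℕ → ℕ) := inferInstance
  have hP3 : PolishSpace ((ℕ → CantorC) × (ℕ → ℕ)) := inferInstance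
  have hP4 : PolishSpace ((ℕ → ℕ) × (ℕ → CantorC) × (ℕ → ℕ)) := inferInstance
  apply MeasurableSet.analyticSet
  have e : relR f = (⋂ n : ℕ, ⋂ q : Fin n → ℚ,
      {p | ‖∑ j : Fin n, (q j : ℝ) • p.2.1 j‖ =
        Metric.infDist (∑ j : Fin n, (q j : ℝ) • eB j) ((f p.1).1 : Set CantorC)}) ∩
      ⋂ n : ℕ, ⋂ j : ℕ, ⋂ _ : j ≤ n, {p | ‖p.2.1 j - PB (p.2.2 n) (p.2.1 j)‖ ≤ epsS n} := by
    ext p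
    simp only [relR, ThetaQ, NFor, Set.mem_ofPred_eq, Set.mem_inter_iff, Set.mem_iInter]
  rw [e]
  refine MeasurableSet.inter ?_ ?_
  · refine MeasurableSet.iInter fun n => MeasurableSet.iInter fun q => ?_
    refine measurableSet_eq_fun ?_ ?_
    · refine Continuous.measurable (Continuous.norm (continuous_finsetSum _ fun j _ => ?_))
      have hj : Continuous fun p : (ℕ → ℕ) × (ℕ → CantorC) × (ℕ → ℕ) => p.2.1 (j : ℕ) :=
        (continuous_apply (j : ℕ)).comp (continuous_fst.comp continuous_snd)
      exact hj.const_smul (q j : ℝ)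
    · exact (measurable_infDist_SB _).comp (hf.comp measurable_fst)
  · refine MeasurableSet.iInter fun n => MeasurableSet.iInter fun j =>
      MeasurableSet.iInter fun _ => ?_
    exact (isClosed_le ((continuous_NFor_aux n j).comp continuous_snd)
      continuous_const).measurableSet

theorem isClosed_map_YV (I : BB →ₗᵢ[ℝ] CantorC) (θ : ℕ → CantorC) (N : ℕ → ℕ) :
    IsClosed (((YV θ N).map I.toLinearMap : Submodule ℝ CantorC) : Set CantorC) := by
  rw [Submodule.map_coe]
  exact I.isometry.isClosedEmbedding.isClosedMap _ (Submodule.isClosed_topologicalClosure _)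

/-- The space attached to the parameters. -/
def PhiY (I : BB →ₗᵢ[ℝ] CantorC) (p : (ℕ → CantorC) × (ℕ → ℕ)) : SB :=
  ⟨(YV p.1 p.2).map I.toLinearMap, isClosed_map_YV I p.1 p.2⟩

theorem bV_mem (θ : ℕ → CantorC) (N : ℕ → ℕ) (J : ℕ) : bV θ N J ∈ YV θ N :=
  Submodule.le_topologicalClosure _ (Submodule.subset_span ⟨J, rfl⟩)

theorem PhiY_inter_iff (I : BB →ₗᵢ[ℝ] CantorC) {X : Submodule ℝ CantorC} {θ : ℕ → CantorC}
    (hθ : ThetaFor X θ) (N : ℕ → ℕ) (U : Set CantorC) (hU : IsOpen U) :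
    (((PhiY I (θ, N)).1 : Set CantorC) ∩ U).Nonempty ↔
      ∃ (n : ℕ) (q : Fin n → ℚ), I (∑ j : Fin n, (q j : ℝ) • bV θ N j) ∈ U := by
  constructor
  · rintro ⟨_, ⟨y, hy, rfl⟩, hyU⟩
    obtain ⟨a, ha, -⟩ := bV_basis hθ N y hy
    have hU' : IsOpen (I ⁻¹' U) := hU.preimage I.continuous
    obtain ⟨n, hn⟩ := (ha.eventually (hU'.mem_nhds hyU)).exists
    rw [Finset.sum_range] at hn
    have hc : Continuous fun t : Fin n → ℝ => ∑ j : Fin n, t j • bV θ N j :=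
      continuous_finsetSum _ fun j _ => (continuous_apply j).smul continuous_const
    obtain ⟨q, hq⟩ := (denseRange_ratVec n).exists_mem_open (hU'.preimage hc) ⟨fun j => a j, hn⟩
    exact ⟨n, q, hq⟩
  · rintro ⟨n, q, hq⟩
    refine ⟨_, ⟨_, ?_, rfl⟩, hq⟩
    exact Submodule.sum_mem _ fun j _ => Submodule.smul_mem _ _ (bV_mem _ _ _)

theorem measurable_PhiY (I : BB →ₗᵢ[ℝ] CantorC) (u : (ℕ → ℕ) → (ℕ → CantorC) × (ℕ → ℕ))
    (hu : Continuous u) (hθ : ∀ x, ∃ X : Submodule ℝ CantorC, ThetaFor X (u x).1) :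
    Measurable fun x => PhiY I (u x) := by
  refine measurable_generateFrom ?_
  rintro _ ⟨U, hU, rfl⟩
  have e : (fun x => PhiY I (u x)) ⁻¹' {Y : SB | ((Y.1 : Set CantorC) ∩ U).Nonempty} =
      ⋃ n : ℕ, ⋃ q : Fin n → ℚ,
        {x | I (∑ j : Fin n, (q j : ℝ) • bV (u x).1 (u x).2 j) ∈ U} := by
    ext x
    obtain ⟨X, hX⟩ := hθ x
    simp only [Set.mem_iUnion]
    exact PhiY_inter_iff I hX (u x).2 U hU
  rw [e]
  refine IsOpen.measurableSet (isOpen_iUnion fun n => isOpen_iUnion fun q => ?_)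
  refine hU.preimage (I.continuous.comp (continuous_finsetSum _ fun j _ => ?_))
  exact ((continuous_bV j).comp hu).const_smul (q j : ℝ)

theorem PhiY_basis (I : BB →ₗᵢ[ℝ] CantorC) {X : Submodule ℝ CantorC} {θ : ℕ → CantorC}
    (hθ : ThetaFor X θ) (N : ℕ → ℕ) : HasSchauderBasis (PhiY I (θ, N)).1 := by
  refine ⟨fun J => ⟨I (bV θ N J), ⟨_, bV_mem θ N J, rfl⟩⟩, ?_⟩
  rintro ⟨_, ⟨y, hy, rfl⟩⟩
  have key : ∀ a : ℕ → ℝ, Tendsto (fun m => ∑ n ∈ Finset.range m,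
      a n • (⟨I (bV θ N n), ⟨_, bV_mem θ N n, rfl⟩⟩ : (PhiY I (θ, N)).1)) atTop
      (𝓝 ⟨I y, ⟨y, hy, rfl⟩⟩) ↔
      Tendsto (fun m => ∑ n ∈ Finset.range m, a n • bV θ N n) atTop (𝓝 y) := by
    intro a
    rw [tendsto_subtype_rng, I.isometry.isEmbedding.tendsto_nhds_iff]
    refine iff_of_eq (congrArg (fun g => Tendsto g atTop (𝓝 (I y))) ?_)
    funext m
    simp [map_sum, map_smul]
  obtain ⟨a, ha, hua⟩ := bV_basis hθ N y hy
  exact ⟨a, (key a).2 ha, fun b hb => hua b ((key b).1 hb)⟩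

theorem PhiY_embeds (I : BB →ₗᵢ[ℝ] CantorC) {X : Submodule ℝ CantorC} {θ : ℕ → CantorC}
    {N : ℕ → ℕ} (hθ : ThetaFor X θ) (hN : NFor θ N) :
    EmbedsIsometrically X (PhiY I (θ, N)).1 := by
  obtain ⟨S⟩ := embed_YV hθ hN
  refine ⟨⟨LinearMap.codRestrict _ (I.toLinearMap ∘ₗ (YV θ N).subtype ∘ₗ S.toLinearMap)
    fun x => ⟨_, (S x).2, rfl⟩, fun x => ?_⟩⟩
  show ‖I (S x : BB)‖ = ‖x‖
  rw [I.norm_map]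
  exact S.norm_map x

theorem embeds_of_map {C E F : Type*} [NormedAddCommGroup C] [NormedSpace ℝ C]
    [NormedAddCommGroup E] [NormedSpace ℝ E] [NormedAddCommGroup F] [NormedSpace ℝ F]
    (I : E →ₗᵢ[ℝ] F) (Y : Submodule ℝ E)
    (h : Embeds C (Y.map I.toLinearMap)) : Embeds C Y := by
  obtain ⟨T, c, hc, hT⟩ := h
  have hT' : ∀ g, ∃ y : Y, I y = (T g : F) := by
    intro g
    obtain ⟨y, hy, h⟩ := (T g).2
    exact ⟨⟨y, hy⟩, h⟩
  choose S hS using hT'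
  have hinj : ∀ a b : Y, I a = I b → a = b := fun a b h => Subtype.ext (I.injective h)
  have hn : ∀ g, ‖S g‖ = ‖T g‖ := by
    intro g
    have h1 : ‖I (S g : E)‖ = ‖(S g : E)‖ := I.norm_map _
    rw [hS g] at h1
    exact h1.symm
  let L : C →ₗ[ℝ] Y :=
    { toFun := S
      map_add' := fun a b => hinj _ _ (by
        rw [Submodule.coe_add, map_add, hS, hS, hS, map_add]; rfl)
      map_smul' := fun r a => hinj _ _ (by
        rw [RingHom.id_apply, Submodule.coe_smul, map_smul, hS, hS, map_smul]; rfl) }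
  refine ⟨L.mkContinuous ‖T‖ fun g => ?_, c, hc, fun g => ?_⟩
  · show ‖S g‖ ≤ _
    rw [hn]; exact T.le_opNorm g
  · show _ ≤ ‖S g‖
    rw [hn]; exact hT g

theorem PhiY_mem_NU (I : BB →ₗᵢ[ℝ] CantorC) {X : Submodule ℝ CantorC} {θ : ℕ → CantorC}
    {N : ℕ → ℕ} (hX : IsClosed (X : Set CantorC)) (hθ : ThetaFor X θ)
    (hU : ¬ Embeds CantorC X) : PhiY I (θ, N) ∈ NU := by
  intro h
  exact not_embeds_YV (N := N) hX hθ hU (embeds_of_map I (YV θ N) h)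

theorem main_aux (A : Set SB) (hA : IsAnalyticIn A) (hAsub : A ⊆ NU) :
    ∃ A' : Set SB, IsAnalyticIn A' ∧ A' ⊆ NU ∧ (∀ Y ∈ A', HasSchauderBasis ↥Y.1) ∧
      (∀ X ∈ A, ∃ Y ∈ A', EmbedsIsometrically ↥X.1 ↥Y.1) := by
  obtain ⟨f, hf, rfl⟩ := hA
  obtain ⟨I⟩ := exists_IB
  have hex : ∀ x, ∃ θN, (x, θN) ∈ relR f := by
    intro x
    obtain ⟨θ, hθ⟩ := exists_theta (f x).1 (f x).2
    obtain ⟨N, hN⟩ := exists_NFor θ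
    exact ⟨(θ, N), thetaQ_of_thetaFor hθ, hN⟩
  have hR := relR_analytic f hf
  rw [AnalyticSet] at hR
  rcases hR with h | ⟨u, hu, hur⟩
  · obtain ⟨θN, h'⟩ := hex 0
    rw [h] at h'
    exact h'.elim
  have hmem : ∀ x, ThetaFor (f (u x).1).1 (u x).2.1 ∧ NFor (u x).2.1 (u x).2.2 := by
    intro x
    have : u x ∈ relR f := hur ▸ Set.mem_range_self x
    exact ⟨thetaFor_of_thetaQ this.1, this.2⟩
  refine ⟨Set.range fun x => PhiY I (u x).2, ⟨_, measurable_PhiY I (fun x => (u x).2)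
    (continuous_snd.comp hu) (fun x => ⟨_, (hmem x).1⟩), rfl⟩, ?_, ?_, ?_⟩
  · rintro _ ⟨x, rfl⟩
    exact PhiY_mem_NU I (f (u x).1).2 (hmem x).1 (hAsub ⟨_, rfl⟩)
  · rintro _ ⟨x, rfl⟩
    exact PhiY_basis I (hmem x).1 (u x).2.2
  · rintro _ ⟨x, rfl⟩
    obtain ⟨θN, h⟩ := hex x
    rw [← hur] at h
    obtain ⟨z, hz⟩ := h
    refine ⟨_, ⟨z, rfl⟩, ?_⟩
    have h1 := PhiY_embeds I (hmem z).1 (hmem z).2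
    rw [hz] at h1
    show EmbedsIsometrically _ (PhiY I (u z).2).1
    rw [hz]
    exact h1

end

/-- **Corollary.** For every analytic subset `A` of `NU` there is an analytic subset
`A'` of `NU` such that every `Y ∈ A'` has a Schauder basis and every `X ∈ A` admits a
`Y ∈ A'` containing an isometric copy of `X`. -/
theorem analytic_NU_subset_with_bases (A : Set SB) (hA : IsAnalyticIn A)
    (hAsub : A ⊆ NU) :
    ∃ A' : Set SB, IsAnalyticIn A' ∧ A' ⊆ NU ∧
      (∀ Y ∈ A', HasSchauderBasis ↥Y.1) ∧
      (∀ X ∈ A, ∃ Y ∈ A', EmbedsIsometrically ↥X.1 ↥Y.1) := by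
  exact main_aux A hA hAsub
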